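/- arXiv:1606.02135 — 3 statements merged into one kernel-verified Lean document; each statement's English description precedes it below -/
import Mathlib

section
/- Let K be an algebraically closed field of characteristic 2 and let X ⊂ ℙ³ be the quartic surface defined by x₀⁴ + x₁x₂³ + x₁³x₃ + x₀x₂x₃² = 0. Then the set of lines lying on X is finite and has exactly 20 elements. -/
open MvPolynomial

/-- The quartic `x₀⁴ + x₁x₂³ + x₁³x₃ + x₀x₂x₃²`. -/
noncomputable def exQuartic (K : Type*) [Field K] : MvPolynomial (Fin 4) K :=
  X 0 ^ 4 + X 1 * X 2 ^ 3 + X 1 ^ 3 * X 3 + X 0 * X 2 * X 3 ^ 2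

section

variable {K : Type*} [Field K]

lemma eval_exQuartic (v : Fin 4 → K) :
    eval v (exQuartic K) = v 0 ^ 4 + v 1 * v 2 ^ 3 + v 1 ^ 3 * v 3 + v 0 * v 2 * v 3 ^ 2 := by
  simp [exQuartic]

lemma coeffs_eq_zero_of_forall_quartic_eq_zero [Infinite K] {a b c d e : K}
    (h : ∀ t : K, a + b * t + c * t ^ 2 + d * t ^ 3 + e * t ^ 4 = 0) :
    a = 0 ∧ b = 0 ∧ c = 0 ∧ d = 0 ∧ e = 0 := by
  have hp : (Polynomial.C a + Polynomial.C b * Polynomial.X + Polynomial.C c * Polynomial.X ^ 2 +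
      Polynomial.C d * Polynomial.X ^ 3 + Polynomial.C e * Polynomial.X ^ 4) = 0 :=
    Polynomial.funext fun t => by simpa using h t
  refine ⟨?_, ?_, ?_, ?_, ?_⟩
  · simpa [Polynomial.coeff_X, Polynomial.coeff_C] using congrArg (Polynomial.coeff · 0) hp
  · simpa [Polynomial.coeff_X, Polynomial.coeff_C] using congrArg (Polynomial.coeff · 1) hp
  · simpa [Polynomial.coeff_X, Polynomial.coeff_C] using congrArg (Polynomial.coeff · 2) hp
  · simpa [Polynomial.coeff_X, Polynomial.coeff_C] using congrArg (Polynomial.coeff · 3) hp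
  · simpa [Polynomial.coeff_X, Polynomial.coeff_C] using congrArg (Polynomial.coeff · 4) hp

variable (K) in
/-- The quasi-elliptic line `x₀ = x₁ = 0`. -/
def quasiEllipticLine : Submodule K (Fin 4 → K) :=
  Submodule.span K {![0, 0, 1, 0], ![0, 0, 0, 1]}

/-- The line `x₀ = m¹⁵ x₁`, `x₂ = m x₁ + m¹⁷ x₃`, which lies on the quartic when `m¹⁹ = 1`. -/
def incidentLine (m : K) : Submodule K (Fin 4 → K) :=
  Submodule.span K {![m ^ 15, 1, m, 0], ![0, 0, m ^ 17, 1]}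

lemma mem_quasiEllipticLine {v : Fin 4 → K} :
    v ∈ quasiEllipticLine K ↔ v 0 = 0 ∧ v 1 = 0 := by
  rw [quasiEllipticLine, Submodule.mem_span_pair]
  constructor
  · rintro ⟨a, b, rfl⟩
    simp
  · rintro ⟨h0, h1⟩
    refine ⟨v 2, v 3, ?_⟩
    ext i
    fin_cases i <;> simp [h0, h1]

lemma mem_incidentLine {m : K} {v : Fin 4 → K} :
    v ∈ incidentLine m ↔ v 0 = m ^ 15 * v 1 ∧ v 2 = m * v 1 + m ^ 17 * v 3 := by
  rw [incidentLine, Submodule.mem_span_pair]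
  constructor
  · rintro ⟨a, b, rfl⟩
    simp [mul_comm]
  · rintro ⟨h0, h2⟩
    refine ⟨v 1, v 3, ?_⟩
    ext i
    fin_cases i <;> simp [h0, h2, mul_comm]

lemma finrank_quasiEllipticLine : Module.finrank K (quasiEllipticLine K) = 2 := by
  have h : LinearIndependent K ![(![0, 0, 1, 0] : Fin 4 → K), ![0, 0, 0, 1]] := by
    rw [LinearIndependent.pair_iff]
    intro s t hst
    exact ⟨by simpa using congrFun hst 2, by simpa using congrFun hst 3⟩
  rw [quasiEllipticLine, ← Matrix.range_cons_cons_empty _ _ ![], finrank_span_eq_card h,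
    Fintype.card_fin]

lemma finrank_incidentLine (m : K) : Module.finrank K (incidentLine m) = 2 := by
  have h : LinearIndependent K ![(![m ^ 15, 1, m, 0] : Fin 4 → K), ![0, 0, m ^ 17, 1]] := by
    rw [LinearIndependent.pair_iff]
    intro s t hst
    exact ⟨by simpa using congrFun hst 1, by simpa using congrFun hst 3⟩
  rw [incidentLine, ← Matrix.range_cons_cons_empty _ _ ![], finrank_span_eq_card h,
    Fintype.card_fin]

lemma incidentLine_injective : Function.Injective (incidentLine : K → Submodule K (Fin 4 → K)) := by
  intro m n h
  have hm : ![m ^ 15, 1, m, 0] ∈ incidentLine n := h ▸ Submodule.subset_span (by simp)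
  simpa using (mem_incidentLine.1 hm).2

lemma quasiEllipticLine_ne_incidentLine (m : K) : quasiEllipticLine K ≠ incidentLine m := by
  intro h
  have hm : ![m ^ 15, 1, m, 0] ∈ quasiEllipticLine K := h ▸ Submodule.subset_span (by simp)
  simpa using (mem_quasiEllipticLine.1 hm).2

lemma eval_exQuartic_of_mem_quasiEllipticLine {v : Fin 4 → K} (hv : v ∈ quasiEllipticLine K) :
    eval v (exQuartic K) = 0 := by
  obtain ⟨h0, h1⟩ := mem_quasiEllipticLine.1 hv
  simp [eval_exQuartic, h0, h1]

lemma eval_exQuartic_of_mem_incidentLine [CharP K 2] {m : K} (hm : m ^ 19 = 1) {v : Fin 4 → K}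
    (hv : v ∈ incidentLine m) : eval v (exQuartic K) = 0 := by
  obtain ⟨h0, h2⟩ := mem_incidentLine.1 hv
  have htwo : (2 : K) = 0 := CharTwo.two_eq_zero
  rw [eval_exQuartic, h0, h2]
  generalize v 1 = b
  generalize v 3 = d
  have e1 : m ^ 15 = (m ^ 17) ^ 2 := by linear_combination (-m ^ 15) * hm
  have e2 : m ^ 17 * m ^ 2 = 1 := by linear_combination hm
  have e3 : (m ^ 17) ^ 8 = m ^ 3 := by
    calc (m ^ 17) ^ 8 = (m ^ 19) ^ 7 * m ^ 3 := by ring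
      _ = m ^ 3 := by rw [hm]; ring
  rw [e1]
  generalize m ^ 17 = w at *
  linear_combination b ^ 4 * e3 + 3 * b ^ 3 * d * e2 +
    (b ^ 4 * m ^ 3 + 2 * b ^ 3 * d + 2 * m * w ^ 2 * b ^ 2 * d ^ 2 + w ^ 3 * b * d ^ 3) * htwo

/-- Every line on the quartic meets the quasi-elliptic line. -/
lemma exists_ne_zero_mem_of_eval_exQuartic_eq_zero [Infinite K] [CharP K 2]
    {W : Submodule K (Fin 4 → K)}
    (hW : Module.finrank K W = 2) (hF : ∀ v ∈ W, eval v (exQuartic K) = 0) :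
    ∃ u ∈ W, u ≠ 0 ∧ u 0 = 0 ∧ u 1 = 0 := by
  have htwo : (2 : K) = 0 := CharTwo.two_eq_zero
  by_contra! H
  let f : W →ₗ[K] (Fin 2 → K) :=
    (LinearMap.funLeft K K (Fin.castLE (by norm_num : 2 ≤ 4))).comp W.subtype
  have hinj : Function.Injective f := by
    rw [injective_iff_map_eq_zero]
    rintro ⟨u, hu⟩ hfu
    have h0 : u 0 = 0 := congrFun hfu 0
    have h1 : u 1 = 0 := congrFun hfu 1
    by_contra hne
    exact H u hu (fun h => hne (by simp [h])) h0 h1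
  have hsurj := (LinearMap.injective_iff_surjective_of_finrank_eq_finrank (by simp [hW])).1 hinj
  obtain ⟨⟨x, hx⟩, hfx⟩ := hsurj ![1, 0]
  obtain ⟨⟨y, hy⟩, hfy⟩ := hsurj ![0, 1]
  have hx0 : x 0 = 1 := congrFun hfx 0
  have hx1 : x 1 = 0 := congrFun hfx 1
  have hy0 : y 0 = 0 := congrFun hfy 0
  have hy1 : y 1 = 1 := congrFun hfy 1
  generalize hp : x 2 = p
  generalize hr : x 3 = r
  generalize hq : y 2 = q
  generalize hs : y 3 = s
  obtain ⟨h0, h1, h2, h3, h4⟩ := coeffs_eq_zero_of_forall_quartic_eq_zero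
    (a := 1 + p * r ^ 2) (b := p ^ 3 + q * r ^ 2) (c := p ^ 2 * q + p * s ^ 2)
    (d := p * q ^ 2 + r + q * s ^ 2) (e := q ^ 3 + s) (fun t => by
      have h := hF (x + t • y) (W.add_mem hx (W.smul_mem t hy))
      simp only [eval_exQuartic, Pi.add_apply, Pi.smul_apply, smul_eq_mul, hx0, hx1, hy0, hy1,
        hp, hr, hq, hs] at h
      linear_combination h - (p * r * s * t + p ^ 2 * q * t ^ 2 + q * r * s * t ^ 2 +
        p * q ^ 2 * t ^ 3) * htwo)
  have hp0 : p ≠ 0 := by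
    rintro rfl
    simp at h0
  have hpq : p * q = s ^ 2 := mul_left_cancel₀ hp0 (by linear_combination h2 - p * s ^ 2 * htwo)
  have hr0 : r = 0 := by linear_combination h3 - q * s ^ 2 * htwo - q * hpq
  simp [hr0] at h0

lemma eq_quasiEllipticLine_or_incidentLine [Infinite K] [CharP K 2]
    {W : Submodule K (Fin 4 → K)}
    (hW : Module.finrank K W = 2) (hF : ∀ v ∈ W, eval v (exQuartic K) = 0) :
    W = quasiEllipticLine K ∨ ∃ m : K, m ^ 19 = 1 ∧ incidentLine m = W := by
  have htwo : (2 : K) = 0 := CharTwo.two_eq_zero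
  obtain ⟨u, hu, hune, hu0, hu1⟩ := exists_ne_zero_mem_of_eval_exQuartic_eq_zero hW hF
  by_cases hle : W ≤ quasiEllipticLine K
  · exact .inl (Submodule.eq_of_le_of_finrank_eq hle (by rw [hW, finrank_quasiEllipticLine]))
  right
  obtain ⟨v, hv, hvL⟩ := SetLike.not_le_iff_exists.1 hle
  rw [mem_quasiEllipticLine] at hvL
  have key : ∀ u ∈ W, u 0 = 0 → u 1 = 0 → ∀ v ∈ W,
      v 0 ^ 4 + v 1 * v 2 ^ 3 + v 1 ^ 3 * v 3 + v 0 * v 2 * v 3 ^ 2 = 0 ∧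
      v 1 * v 2 ^ 2 * u 2 + v 1 ^ 3 * u 3 + v 0 * u 2 * v 3 ^ 2 = 0 ∧
      v 1 * v 2 * u 2 ^ 2 + v 0 * v 2 * u 3 ^ 2 = 0 ∧
      v 1 * u 2 ^ 3 + v 0 * u 2 * u 3 ^ 2 = 0 := by
    intro u hu hu0 hu1 v hv
    obtain ⟨h0, h1, h2, h3, -⟩ := coeffs_eq_zero_of_forall_quartic_eq_zero
      (a := v 0 ^ 4 + v 1 * v 2 ^ 3 + v 1 ^ 3 * v 3 + v 0 * v 2 * v 3 ^ 2)
      (b := v 1 * v 2 ^ 2 * u 2 + v 1 ^ 3 * u 3 + v 0 * u 2 * v 3 ^ 2)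
      (c := v 1 * v 2 * u 2 ^ 2 + v 0 * v 2 * u 3 ^ 2)
      (d := v 1 * u 2 ^ 3 + v 0 * u 2 * u 3 ^ 2) (e := 0) (fun t => by
        have h := hF (v + t • u) (W.add_mem hv (W.smul_mem t hu))
        simp only [eval_exQuartic, Pi.add_apply, Pi.smul_apply, smul_eq_mul, hu0, hu1] at h
        linear_combination h - (v 1 * v 2 ^ 2 * u 2 * t + v 1 * v 2 * u 2 ^ 2 * t ^ 2 +
          v 0 * v 2 * v 3 * u 3 * t + v 0 * u 2 * v 3 * u 3 * t ^ 2) * htwo)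
    exact ⟨h0, h1, h2, h3⟩
  have hu23 : ¬ (u 2 = 0 ∧ u 3 = 0) := by
    rintro ⟨h2, h3⟩
    apply hune
    ext i
    fin_cases i <;> assumption
  obtain ⟨k0, k1, k2, k3⟩ := key u hu hu0 hu1 v hv
  have hv1 : v 1 ≠ 0 := by
    intro h
    have hv0 : v 0 ≠ 0 := fun h0 => hvL ⟨h0, h⟩
    simp only [h] at k0 k1 k2 k3
    simp [hv0] at k0 k1 k2 k3
    grind
  have hu3 : u 3 ≠ 0 := by
    intro h
    simp [h, hv1] at k3
    exact hu23 ⟨k3, h⟩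
  obtain ⟨l0, l1, l2, l3⟩ := key ((u 3)⁻¹ • u) (W.smul_mem _ hu) (by simp [hu0]) (by simp [hu1])
    ((v 1)⁻¹ • v) (W.smul_mem _ hv)
  have hu' := W.smul_mem (u 3)⁻¹ hu
  have hv' := W.smul_mem (v 1)⁻¹ hv
  have hu0' : ((u 3)⁻¹ • u) 0 = 0 := by simp [hu0]
  have hu1' : ((u 3)⁻¹ • u) 1 = 0 := by simp [hu1]
  have hu3' : ((u 3)⁻¹ • u) 3 = 1 := by simp [hu3]
  have hv1' : ((v 1)⁻¹ • v) 1 = 1 := by simp [hv1]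
  generalize (u 3)⁻¹ • u = x at *
  generalize (v 1)⁻¹ • v = y at *
  simp only [hu3', hv1'] at l0 l1 l2 l3
  generalize hw : x 2 = w at *
  generalize hc : y 2 = c at *
  generalize hd : y 3 = d at *
  generalize ha : y 0 = a at *
  have hw0 : w ≠ 0 := by
    rintro rfl
    simp at l1
  have haw : a = w ^ 2 := mul_left_cancel₀ hw0 (by linear_combination l3 - w ^ 3 * htwo)
  subst haw
  have hm2 : w * (c + w * d) ^ 2 = 1 := by
    linear_combination l1 - (1 - w ^ 2 * c * d) * htwo
  have hm3 : (c + w * d) ^ 3 = w ^ 8 := by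
    linear_combination l0 + d * l1 + (c ^ 2 * w * d + w ^ 2 * c * d ^ 2 - w ^ 8 - d) * htwo
  obtain ⟨m, rfl⟩ : ∃ m, c = m + w * d := ⟨c + w * d, by linear_combination (- w * d) * htwo⟩
  have hmm : m + w * d + w * d = m := by linear_combination w * d * htwo
  rw [hmm] at hm2 hm3
  have hm19 : m ^ 19 = 1 := by
    calc m ^ 19 = m ^ 16 * m ^ 3 := by ring
      _ = (w * m ^ 2) ^ 8 := by rw [hm3]; ring
      _ = 1 := by rw [hm2, one_pow]
  have hwm : w = m ^ 17 := by linear_combination m ^ 17 * hm2 - w * hm19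
  have hwm2 : w ^ 2 = m ^ 15 := by
    rw [hwm]
    linear_combination m ^ 15 * hm19
  refine ⟨m, hm19, Submodule.eq_of_le_of_finrank_eq (fun z hz => ?_)
    (by rw [hW, finrank_incidentLine])⟩
  obtain ⟨hz0, hz2⟩ := mem_incidentLine.1 hz
  have hz : z = z 1 • y + (z 3 - z 1 * d) • x := by
    ext i
    fin_cases i
    · simp [ha, hu0', hz0, hwm2, mul_comm]
    · simp [hv1', hu1']
    · simp only [Fin.reduceFinMk, Pi.add_apply, Pi.smul_apply, smul_eq_mul, hc, hw]
      linear_combination hz2 - z 3 * hwm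
    · simp [hd, hu3']
  rw [hz]
  exact W.add_mem (W.smul_mem _ hv') (W.smul_mem _ hu')

end

/-- Over an algebraically closed field of characteristic 2, the
quartic `x₀⁴ + x₁x₂³ + x₁³x₃ + x₀x₂x₃² = 0` contains exactly 20 lines.  Lines of ℙ³
are represented by 2-dimensional linear subspaces of `K⁴`. -/
theorem exQuartic_exactly_20_lines (K : Type*) [Field K] [IsAlgClosed K] [CharP K 2] :
    {W : Submodule K (Fin 4 → K) |
        Module.finrank K W = 2 ∧ ∀ v ∈ W, eval v (exQuartic K) = 0}.Finite ∧
    {W : Submodule K (Fin 4 → K) |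
        Module.finrank K W = 2 ∧ ∀ v ∈ W, eval v (exQuartic K) = 0}.ncard = 20 := by
  have : Infinite K := IsAlgClosed.instInfinite
  have : NeZero (19 : K) := ⟨by
    have h := CharTwo.two_eq_zero (R := K)
    intro h19
    exact one_ne_zero (α := K) (by linear_combination h19 - 9 * h)⟩
  have hS : {W : Submodule K (Fin 4 → K) |
        Module.finrank K W = 2 ∧ ∀ v ∈ W, eval v (exQuartic K) = 0} =
      insert (quasiEllipticLine K) (incidentLine '' {m : K | m ^ 19 = 1}) := by
    ext W
    constructor
    · rintro ⟨hW, hF⟩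
      exact eq_quasiEllipticLine_or_incidentLine hW hF
    · rintro (rfl | ⟨m, hm, rfl⟩)
      · exact ⟨finrank_quasiEllipticLine, fun v => eval_exQuartic_of_mem_quasiEllipticLine⟩
      · exact ⟨finrank_incidentLine m, fun v => eval_exQuartic_of_mem_incidentLine hm⟩
  have hroots : {m : K | m ^ 19 = 1} = (Polynomial.nthRootsFinset 19 (1 : K) : Set K) := by
    ext m
    simp
  have hfin : (incidentLine '' {m : K | m ^ 19 = 1}).Finite := by
    rw [hroots]
    exact (Finset.finite_toSet _).image _
  have hcard : {m : K | m ^ 19 = 1}.ncard = 19 := by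
    rw [hroots, Set.ncard_coe_finset]
    have : NeZero ((19 : ℕ) : K) := by simpa
    obtain ⟨ζ, hζ⟩ := HasEnoughRootsOfUnity.exists_primitiveRoot K 19
    exact hζ.card_nthRootsFinset
  rw [hS]
  refine ⟨hfin.insert _, ?_⟩
  rw [Set.ncard_insert_of_notMem ?_ hfin, Set.ncard_image_of_injective _ incidentLine_injective,
    hcard]
  rintro ⟨m, -, hm⟩
  exact quasiEllipticLine_ne_incidentLine m hm.symm
end

section
/- Let K be an algebraically closed field of characteristic 2 and let X ⊂ ℙ³ be the quartic surface defined by F = x₀⁴ + x₁x₂³ + x₁³x₃ + x₀x₂x₃². Then the set of singular points of X is exactly the single point {[0:0:0:1]}; that is, [0:0:0:1] lies on X, all four partial derivatives of F vanish there, and at every other point of X some partial derivative of F is nonzero. -/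
open MvPolynomial

/-- Over an algebraically closed field of characteristic 2, the
singular locus of the quartic `x₀⁴ + x₁x₂³ + x₁³x₃ + x₀x₂x₃² = 0` is exactly the
single point `[0:0:0:1]`: that point lies on the surface with all four partial
derivatives vanishing, and at every point of the surface represented by a nonzero
vector that is not a scalar multiple of `(0,0,0,1)` some partial derivative is
nonzero. -/
theorem exQuartic_singular_locus (K : Type*) [Field K] [IsAlgClosed K] [CharP K 2] :
    eval (![0, 0, 0, 1] : Fin 4 → K) (exQuartic K) = 0 ∧
    (∀ i : Fin 4, eval (![0, 0, 0, 1] : Fin 4 → K) (pderiv i (exQuartic K)) = 0) ∧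
    (∀ v : Fin 4 → K, v ≠ 0 → eval v (exQuartic K) = 0 →
      (¬ ∃ c : K, v = c • ![0, 0, 0, 1]) →
      ∃ i : Fin 4, eval v (pderiv i (exQuartic K)) ≠ 0) := by
  have two : (2 : K) = 0 := CharTwo.two_eq_zero
  refine ⟨by simp [exQuartic], fun i ↦ ?_, fun v _ hF hv ↦ ?_⟩
  · fin_cases i <;> simp [exQuartic, pderiv_X]
  · by_contra! h
    have h1 := h 1
    have h3 := h 3
    simp [exQuartic, pderiv_X] at hF h1 h3
    have hb : v 1 = 0 := by
      refine pow_eq_zero_iff (n := 3) (by norm_num) |>.mp ?_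
      linear_combination h3 - v 0 * v 2 * v 3 * two
    have hc : v 2 = 0 := by
      refine pow_eq_zero_iff (n := 3) (by norm_num) |>.mp ?_
      linear_combination h1 - 3 * v 1 * v 3 * hb
    have ha : v 0 = 0 := by simpa [hb, hc] using hF
    refine hv ⟨v 3, ?_⟩
    ext i
    fin_cases i <;> simp [ha, hb, hc]
end

section
/- Let K be an algebraically closed field of characteristic 2 and F = Σ a_{i₀i₁i₂i₃} x₀^{i₀}x₁^{i₁}x₂^{i₂}x₃^{i₃} a quartic form with a_{i₀i₁00} = 0, so the line ℓ : x₀ = x₁ = 0 lies on X = {F = 0}, and suppose ℓ has positive degree d. Let R(ℓ) ∈ K[x₂,x₃] be the resultant of ℓ. Then: (a) if a line lying on X and distinct from ℓ meets ℓ at a smooth point P = [0:0:p₂:p₃] of X, then (p₂,p₃) is a zero of R(ℓ), i.e., the linear form p₃·x₂ − p₂·x₃ divides R(ℓ); (b) if two distinct such lines meet ℓ at the same smooth point P, or some residual cubic E_t has a linear component of multiplicity ≥ 2 passing through the smooth point P, then (p₃·x₂ − p₂·x₃)² divides R(ℓ); (c) if three distinct such lines meet ℓ at P, or some residual cubic E_t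 through P factors as a double line through P times a further line through P, or as a triple line through P, then (p₃·x₂ − p₂·x₃)⁵ divides R(ℓ). -/
open MvPolynomial

noncomputable section

/-- The exponent vector `(a, b, c, d)` as a monomial index for `MvPolynomial (Fin 4)`. -/
def expo (a b c d : ℕ) : Fin 4 →₀ ℕ := Finsupp.equivFunOnFinite.symm ![a, b, c, d]

/-- The line `ℓ : x₀ = x₁ = 0`. -/
def ell (K : Type*) [Field K] : Submodule K (Fin 4 → K) :=
  Submodule.span K {![0, 0, 1, 0], ![0, 0, 0, 1]}

variable (K : Type*) [Field K]

/-- The binary cubic form `α = Σ_{j+k=3} a_{10jk} x₂^j x₃^k`, where `X 0 = x₂`,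
`X 1 = x₃`. -/
def alphaForm (F : MvPolynomial (Fin 4) K) : MvPolynomial (Fin 2) K :=
  ∑ j ∈ Finset.range 4, C (coeff (expo 1 0 j (3 - j)) F) * X 0 ^ j * X 1 ^ (3 - j)

/-- The binary cubic form `β = Σ_{j+k=3} a_{01jk} x₂^j x₃^k`. -/
def betaForm (F : MvPolynomial (Fin 4) K) : MvPolynomial (Fin 2) K :=
  ∑ j ∈ Finset.range 4, C (coeff (expo 0 1 j (3 - j)) F) * X 0 ^ j * X 1 ^ (3 - j)

/-- The coefficient `c_{ijk}(t) = Σ_{i₀+i₁=i+1} a_{i₀i₁jk}·t^{i₀} ∈ K[t]` of the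
monomial `x₁^i x₂^j x₃^k` in the residual cubic `g_t = F(t·x₁,x₁,x₂,x₃)/x₁`. -/
def cc (F : MvPolynomial (Fin 4) K) (i j k : ℕ) : Polynomial K :=
  ∑ i0 ∈ Finset.range (i + 2),
    Polynomial.C (coeff (expo i0 (i + 1 - i0) j k) F) * Polynomial.X ^ i0

/-- The characteristic-2 hessian `h̃ ∈ K[t][x₂,x₃]` of the residual cubic, i.e. the
reduction modulo 2 of `(1/4)·((1/2)·det(∂²g/∂xᵢ∂xⱼ) − m²·g)|_{x₁=0}` computed with
generic integer coefficients, written out explicitly.  It is an element of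
`Polynomial (MvPolynomial (Fin 2) K)` (a polynomial in `t` whose coefficients are
binary forms in `x₂ = X 0`, `x₃ = X 1`). -/
def hTilde (F : MvPolynomial (Fin 4) K) : Polynomial (MvPolynomial (Fin 2) K) :=
  let c : ℕ → ℕ → ℕ → Polynomial (MvPolynomial (Fin 2) K) := fun i j k =>
    (cc K F i j k).map (MvPolynomial.C : K →+* MvPolynomial (Fin 2) K)
  (c 0 0 3 * c 0 2 1 * c 2 0 1 + c 0 0 3 * c 1 1 1 ^ 2 + c 0 1 2 ^ 2 * c 2 0 1
      + c 0 1 2 * c 1 0 2 * c 1 1 1 + c 0 2 1 * c 1 0 2 ^ 2)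
    * Polynomial.C (X 1 ^ 3)
  + (c 0 0 3 * c 0 2 1 * c 2 1 0 + c 0 0 3 * c 0 3 0 * c 2 0 1
      + c 0 0 3 * c 1 1 1 * c 1 2 0 + c 0 1 2 ^ 2 * c 2 1 0
      + c 0 1 2 * c 0 2 1 * c 2 0 1 + c 0 3 0 * c 1 0 2 ^ 2)
    * Polynomial.C (X 0 * X 1 ^ 2)
  + (c 0 0 3 * c 0 3 0 * c 2 1 0 + c 0 0 3 * c 1 2 0 ^ 2
      + c 0 1 2 * c 0 2 1 * c 2 1 0 + c 0 1 2 * c 0 3 0 * c 2 0 1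
      + c 0 2 1 ^ 2 * c 2 0 1 + c 0 3 0 * c 1 0 2 * c 1 1 1)
    * Polynomial.C (X 0 ^ 2 * X 1)
  + (c 0 1 2 * c 0 3 0 * c 2 1 0 + c 0 1 2 * c 1 2 0 ^ 2 + c 0 2 1 ^ 2 * c 2 1 0
      + c 0 2 1 * c 1 1 1 * c 1 2 0 + c 0 3 0 * c 1 1 1 ^ 2)
    * Polynomial.C (X 0 ^ 3)

/-- The Sylvester matrix of two polynomials `p`, `q` taken with formal degrees 1
and 5 respectively: five staggered rows of coefficients of `p` and one row of
coefficients of `q`. -/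
def sylvester15 {A : Type*} [CommRing A] (p q : Polynomial A) :
    Matrix (Fin 6) (Fin 6) A :=
  Matrix.of fun i j =>
    if (i : ℕ) < 5 then
      (if (i : ℕ) ≤ (j : ℕ) ∧ (j : ℕ) ≤ (i : ℕ) + 1 then p.coeff ((i : ℕ) + 1 - (j : ℕ))
       else 0)
    else q.coeff (5 - (j : ℕ))

/-- The resultant `R(ℓ) = Res_t(t·α̃ + β̃, h̃) ∈ K[x₂,x₃]` of the line
`ℓ : x₀ = x₁ = 0`, computed as the determinant of the Sylvester matrix with formal
degrees 1 and 5 in `t`. -/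
def lineResultant (F : MvPolynomial (Fin 4) K)
    (alphaRed betaRed : MvPolynomial (Fin 2) K) : MvPolynomial (Fin 2) K :=
  (sylvester15 (Polynomial.C alphaRed * Polynomial.X + Polynomial.C betaRed)
    (hTilde K F)).det

end

section CubicForms

variable {A B : Type*} [CommRing A] [CommRing B]

/-- The value at `(x, y, z)` of the ternary cubic form with coefficients `c i j k`. -/
def cubicEval (c : ℕ → ℕ → ℕ → A) (x y z : A) : A :=
  c 0 0 3 * z ^ 3 + c 0 1 2 * (y * z ^ 2) + c 0 2 1 * (y ^ 2 * z) + c 0 3 0 * y ^ 3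
    + x * (c 1 0 2 * z ^ 2 + c 1 1 1 * (y * z) + c 1 2 0 * y ^ 2)
    + x ^ 2 * (c 2 0 1 * z + c 2 1 0 * y) + x ^ 3 * c 3 0 0

/-- The characteristic-2 hessian, restricted to `x = 0`, of the ternary cubic form with
coefficients `c i j k`. -/
def cubicHess (c : ℕ → ℕ → ℕ → A) (y z : A) : A :=
  (c 0 0 3 * c 0 2 1 * c 2 0 1 + c 0 0 3 * c 1 1 1 ^ 2 + c 0 1 2 ^ 2 * c 2 0 1
      + c 0 1 2 * c 1 0 2 * c 1 1 1 + c 0 2 1 * c 1 0 2 ^ 2)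
    * z ^ 3
  + (c 0 0 3 * c 0 2 1 * c 2 1 0 + c 0 0 3 * c 0 3 0 * c 2 0 1
      + c 0 0 3 * c 1 1 1 * c 1 2 0 + c 0 1 2 ^ 2 * c 2 1 0
      + c 0 1 2 * c 0 2 1 * c 2 0 1 + c 0 3 0 * c 1 0 2 ^ 2)
    * (y * z ^ 2)
  + (c 0 0 3 * c 0 3 0 * c 2 1 0 + c 0 0 3 * c 1 2 0 ^ 2
      + c 0 1 2 * c 0 2 1 * c 2 1 0 + c 0 1 2 * c 0 3 0 * c 2 0 1
      + c 0 2 1 ^ 2 * c 2 0 1 + c 0 3 0 * c 1 0 2 * c 1 1 1)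
    * (y ^ 2 * z)
  + (c 0 1 2 * c 0 3 0 * c 2 1 0 + c 0 1 2 * c 1 2 0 ^ 2 + c 0 2 1 ^ 2 * c 2 1 0
      + c 0 2 1 * c 1 1 1 * c 1 2 0 + c 0 3 0 * c 1 1 1 ^ 2)
    * y ^ 3

/-- The coefficients of the ternary cubic form obtained by substituting
`(x, q₂ y + p₂ z, q₃ y + p₃ z)` into the form with coefficients `c i j k`. -/
def cubicSubst (c : ℕ → ℕ → ℕ → A) (q₂ q₃ p₂ p₃ : A) : ℕ → ℕ → ℕ → A
  | 0, 0, 3 => p₂ ^ 3 * c 0 3 0 + p₂ ^ 2 * p₃ * c 0 2 1 + p₂ * p₃ ^ 2 * c 0 1 2 + p₃ ^ 3 * c 0 0 3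
  | 0, 1, 2 => 3 * q₂ * p₂ ^ 2 * c 0 3 0 + 2 * q₂ * p₂ * p₃ * c 0 2 1 + q₂ * p₃ ^ 2 * c 0 1 2
      + q₃ * p₂ ^ 2 * c 0 2 1 + 2 * q₃ * p₂ * p₃ * c 0 1 2 + 3 * q₃ * p₃ ^ 2 * c 0 0 3
  | 0, 2, 1 => 3 * q₂ ^ 2 * p₂ * c 0 3 0 + q₂ ^ 2 * p₃ * c 0 2 1 + 2 * q₂ * q₃ * p₂ * c 0 2 1
      + 2 * q₂ * q₃ * p₃ * c 0 1 2 + q₃ ^ 2 * p₂ * c 0 1 2 + 3 * q₃ ^ 2 * p₃ * c 0 0 3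
  | 0, 3, 0 => q₂ ^ 3 * c 0 3 0 + q₂ ^ 2 * q₃ * c 0 2 1 + q₂ * q₃ ^ 2 * c 0 1 2 + q₃ ^ 3 * c 0 0 3
  | 1, 0, 2 => p₂ ^ 2 * c 1 2 0 + p₂ * p₃ * c 1 1 1 + p₃ ^ 2 * c 1 0 2
  | 1, 1, 1 => 2 * q₂ * p₂ * c 1 2 0 + q₂ * p₃ * c 1 1 1 + q₃ * p₂ * c 1 1 1
      + 2 * q₃ * p₃ * c 1 0 2
  | 1, 2, 0 => q₂ ^ 2 * c 1 2 0 + q₂ * q₃ * c 1 1 1 + q₃ ^ 2 * c 1 0 2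
  | 2, 0, 1 => p₂ * c 2 1 0 + p₃ * c 2 0 1
  | 2, 1, 0 => q₂ * c 2 1 0 + q₃ * c 2 0 1
  | 3, 0, 0 => c 3 0 0
  | _, _, _ => 0

theorem cubicEval_subst (c : ℕ → ℕ → ℕ → A) (q₂ q₃ p₂ p₃ x y z : A) :
    cubicEval c x (q₂ * y + p₂ * z) (q₃ * y + p₃ * z) =
      cubicEval (cubicSubst c q₂ q₃ p₂ p₃) x y z := by
  simp only [cubicEval, cubicSubst]
  ring

theorem map_cubicSubst (f : A →+* B) (c : ℕ → ℕ → ℕ → A) (q₂ q₃ p₂ p₃ : A) (i j k : ℕ) :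
    f (cubicSubst c q₂ q₃ p₂ p₃ i j k) =
      cubicSubst (fun i j k => f (c i j k)) (f q₂) (f q₃) (f p₂) (f p₃) i j k := by
  unfold cubicSubst
  split <;> simp only [map_add, map_mul, map_pow, map_ofNat, map_zero]

theorem cubicSubst_weighted (c : ℕ → ℕ → ℕ → A) (r q₂ q₃ p₂ p₃ : A) (i j k : ℕ) :
    cubicSubst (fun i j k => r ^ (i + 1) * c i j k) q₂ q₃ p₂ p₃ i j k =
      r ^ (i + 1) * cubicSubst c q₂ q₃ p₂ p₃ i j k := by
  unfold cubicSubst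
  split <;> simp only [mul_zero] <;> ring

theorem map_cubicHess (f : A →+* B) (c : ℕ → ℕ → ℕ → A) (y z : A) :
    f (cubicHess c y z) = cubicHess (fun i j k => f (c i j k)) (f y) (f z) := by
  simp [cubicHess]

/-- In characteristic 2 the restricted hessian is invariant under unimodular substitutions
of `(y, z)` at the zeros of the cubic form. -/
theorem cubicHess_subst (h2 : (2 : A) = 0) (c : ℕ → ℕ → ℕ → A) (q₂ q₃ p₂ p₃ y z : A)
    (hdet : q₂ * p₃ - q₃ * p₂ = 1)
    (hc : cubicEval c 0 (q₂ * y + p₂ * z) (q₃ * y + p₃ * z) = 0) :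
    cubicHess c (q₂ * y + p₂ * z) (q₃ * y + p₃ * z) =
      cubicHess (cubicSubst c q₂ q₃ p₂ p₃) y z := by
  let corr : (ℕ → ℕ → ℕ → A) → A → A → A := fun c y z =>
    (c 0 0 3 * c 0 2 1 * c 2 0 1 - c 0 0 3 * c 1 1 1 ^ 2 - c 0 1 2 ^ 2 * c 2 0 1
      - c 0 2 1 * c 1 0 2 ^ 2) * z ^ 3
    + (c 0 0 3 * c 0 2 1 * c 2 1 0 + 4 * c 0 0 3 * c 0 3 0 * c 2 0 1
      - 2 * c 0 0 3 * c 1 1 1 * c 1 2 0 - c 0 1 2 ^ 2 * c 2 1 0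
      - c 0 1 2 * c 0 2 1 * c 2 0 1 + c 0 1 2 * c 1 0 2 * c 1 2 0
      - 2 * c 0 3 0 * c 1 0 2 ^ 2) * (y * z ^ 2)
    + (4 * c 0 0 3 * c 0 3 0 * c 2 1 0 - 2 * c 0 0 3 * c 1 2 0 ^ 2
      - c 0 1 2 * c 0 2 1 * c 2 1 0 + c 0 1 2 * c 0 3 0 * c 2 0 1
      - c 0 2 1 ^ 2 * c 2 0 1 + c 0 2 1 * c 1 0 2 * c 1 2 0
      - 2 * c 0 3 0 * c 1 0 2 * c 1 1 1) * (y ^ 2 * z)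
    + (c 0 1 2 * c 0 3 0 * c 2 1 0 - c 0 1 2 * c 1 2 0 ^ 2 - c 0 2 1 ^ 2 * c 2 1 0
      - c 0 3 0 * c 1 1 1 ^ 2) * y ^ 3
  let hessZ : (ℕ → ℕ → ℕ → A) → A → A → A := fun c y z => cubicHess c y z + 2 * corr c y z
  let e : A := c 1 2 0 * q₂ * p₂ + c 1 0 2 * q₃ * p₃ + c 1 1 1 * p₂ * q₃
  have key : hessZ (cubicSubst c q₂ q₃ p₂ p₃) y z =
      (q₂ * p₃ - q₃ * p₂) ^ 2 * hessZ c (q₂ * y + p₂ * z) (q₃ * y + p₃ * z)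
        - (e ^ 2 + c 1 1 1 * (q₂ * p₃ - q₃ * p₂) * e)
          * cubicEval c 0 (q₂ * y + p₂ * z) (q₃ * y + p₃ * z) := by
    simp only [hessZ, corr, e, cubicHess, cubicSubst, cubicEval]
    ring
  simp only [hc, hdet, hessZ, h2, one_pow, one_mul, zero_mul, mul_zero, add_zero, sub_zero] at key
  exact key.symm

theorem map_cubicHess_eq_zero (h2 : (2 : A) = 0) (c d : ℕ → ℕ → ℕ → A) (a r y z : A) (f : A →+* B)
    (hy : f y = 0) (hf : ∀ i j k, f (c i j k) = f (r ^ (i + 1) * d i j k))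
    (h₀ : d 0 0 3 = 0) (h₁ : d 1 0 2 + a * d 0 1 2 = 0)
    (h₂ : d 2 0 1 + a * d 1 1 1 + a ^ 2 * d 0 2 1 = 0) : f (cubicHess c y z) = 0 := by
  have h : d 0 1 2 ^ 2 * d 2 0 1 + d 0 1 2 * d 1 0 2 * d 1 1 1 + d 0 2 1 * d 1 0 2 ^ 2 = 0 := by
    linear_combination d 0 1 2 ^ 2 * h₂ + d 0 1 2 * d 1 1 1 * h₁
      + d 0 2 1 * (d 1 0 2 - a * d 0 1 2) * h₁ - a * d 1 1 1 * d 0 1 2 ^ 2 * h2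
  rw [map_cubicHess]
  simp only [hf]
  rw [hy, ← map_zero f, ← map_cubicHess f (fun i j k => r ^ (i + 1) * d i j k)]
  congr 1
  simp only [cubicHess, h₀]
  linear_combination r ^ 5 * z ^ 3 * h

theorem sq_dvd_cubicHess (c : ℕ → ℕ → ℕ → A) (y z : A) (h₁ : y ^ 2 ∣ c 0 0 3)
    (h₂ : y ^ 2 ∣ c 0 1 2) (h₃ : y ^ 2 ∣ c 1 0 2) : y ^ 2 ∣ cubicHess c y z := by
  obtain ⟨u, hu⟩ := h₁
  obtain ⟨v, hv⟩ := h₂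
  obtain ⟨w, hw⟩ := h₃
  refine ⟨z ^ 3 * (u * c 0 2 1 * c 2 0 1 + u * c 1 1 1 ^ 2 + y ^ 2 * v ^ 2 * c 2 0 1
      + y ^ 2 * v * w * c 1 1 1 + y ^ 2 * w ^ 2 * c 0 2 1)
    + y * z ^ 2 * (u * c 0 2 1 * c 2 1 0 + u * c 0 3 0 * c 2 0 1 + u * c 1 1 1 * c 1 2 0
      + y ^ 2 * v ^ 2 * c 2 1 0 + v * c 0 2 1 * c 2 0 1 + y ^ 2 * w ^ 2 * c 0 3 0)
    + z * (c 0 0 3 * c 0 3 0 * c 2 1 0 + c 0 0 3 * c 1 2 0 ^ 2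
      + c 0 1 2 * c 0 2 1 * c 2 1 0 + c 0 1 2 * c 0 3 0 * c 2 0 1
      + c 0 2 1 ^ 2 * c 2 0 1 + c 0 3 0 * c 1 0 2 * c 1 1 1)
    + y * (c 0 1 2 * c 0 3 0 * c 2 1 0 + c 0 1 2 * c 1 2 0 ^ 2 + c 0 2 1 ^ 2 * c 2 1 0
      + c 0 2 1 * c 1 1 1 * c 1 2 0 + c 0 3 0 * c 1 1 1 ^ 2), ?_⟩
  simp only [cubicHess, hu, hv, hw]
  ring

theorem pow_five_dvd_cubicHess (c : ℕ → ℕ → ℕ → A) (y z : A) (h₁ : y ^ 3 ∣ c 0 0 3)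
    (h₂ : y ^ 3 ∣ c 0 1 2) (h₃ : y ^ 3 ∣ c 1 0 2) (h₄ : y ^ 3 ∣ c 0 2 1)
    (h₅ : y ^ 3 ∣ c 1 1 1) (h₆ : y ^ 3 ∣ c 2 0 1) : y ^ 5 ∣ cubicHess c y z := by
  obtain ⟨u₁, hu₁⟩ := h₁
  obtain ⟨u₂, hu₂⟩ := h₂
  obtain ⟨u₃, hu₃⟩ := h₃
  obtain ⟨u₄, hu₄⟩ := h₄
  obtain ⟨u₅, hu₅⟩ := h₅
  obtain ⟨u₆, hu₆⟩ := h₆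
  refine ⟨z ^ 3 * y ^ 4 * (u₁ * u₄ * u₆ + u₁ * u₅ ^ 2 + u₂ ^ 2 * u₆ + u₂ * u₃ * u₅ + u₄ * u₃ ^ 2)
    + z ^ 2 * y ^ 2 * (u₁ * u₄ * c 2 1 0 + u₁ * c 0 3 0 * u₆ + u₁ * u₅ * c 1 2 0
      + u₂ ^ 2 * c 2 1 0 + y ^ 3 * u₂ * u₄ * u₆ + c 0 3 0 * u₃ ^ 2)
    + z * (u₁ * c 0 3 0 * c 2 1 0 + u₁ * c 1 2 0 ^ 2 + y ^ 3 * u₂ * u₄ * c 2 1 0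
      + y ^ 3 * u₂ * c 0 3 0 * u₆ + y ^ 6 * u₄ ^ 2 * u₆ + y ^ 3 * c 0 3 0 * u₃ * u₅)
    + y * (u₂ * c 0 3 0 * c 2 1 0 + u₂ * c 1 2 0 ^ 2 + y ^ 3 * u₄ ^ 2 * c 2 1 0
      + y ^ 3 * u₄ * u₅ * c 1 2 0 + y ^ 3 * c 0 3 0 * u₅ ^ 2), ?_⟩
  simp only [cubicHess, hu₁, hu₂, hu₃, hu₄, hu₅, hu₆]
  ring

end CubicForms

section Resultant

variable {A : Type*} [CommRing A]

/-- `HomogenizesTo n b a p r` means that `p` has degree at most `n` and that its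
homogenization of degree `n` takes the value `r` at `(b, a)`. -/
def HomogenizesTo (n : ℕ) (b a : A) (p : Polynomial A) (r : A) : Prop :=
  p.natDegree ≤ n ∧ eval ![b, a] (p.homogenize n) = r

theorem HomogenizesTo.add {n : ℕ} {b a r s : A} {p q : Polynomial A}
    (hp : HomogenizesTo n b a p r) (hq : HomogenizesTo n b a q s) :
    HomogenizesTo n b a (p + q) (r + s) :=
  ⟨Polynomial.natDegree_add_le_of_degree_le hp.1 hq.1, by simp [hp.2, hq.2]⟩

theorem HomogenizesTo.mul {m n : ℕ} {b a r s : A} {p q : Polynomial A}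
    (hp : HomogenizesTo m b a p r) (hq : HomogenizesTo n b a q s) :
    HomogenizesTo (m + n) b a (p * q) (r * s) :=
  ⟨Polynomial.natDegree_mul_le_of_le hp.1 hq.1, by
    rw [Polynomial.homogenize_mul _ _ hp.1 hq.1, map_mul, hp.2, hq.2]⟩

theorem HomogenizesTo.sq {n : ℕ} {b a r : A} {p : Polynomial A}
    (hp : HomogenizesTo n b a p r) : HomogenizesTo (n + n) b a (p ^ 2) (r ^ 2) := by
  simpa only [_root_.sq] using hp.mul hp

theorem HomogenizesTo.const (b a r : A) : HomogenizesTo 0 b a (Polynomial.C r) r :=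
  ⟨by simp, by simp⟩

theorem HomogenizesTo.sum_coeff {n : ℕ} {b a r : A} {p : Polynomial A}
    (hp : HomogenizesTo n b a p r) :
    ∑ i ∈ Finset.range (n + 1), p.coeff i * b ^ i * a ^ (n - i) = r := by
  rw [← hp.2, Polynomial.homogenize, Finset.Nat.sum_antidiagonal_eq_sum_range_succ_mk, map_sum]
  refine Finset.sum_congr rfl fun i hi => ?_
  rw [eval_monomial, Finsupp.update_eq_add_single (by simp), Finsupp.prod_add_index' (by simp)
    (by simp [pow_add])]
  simp [mul_assoc]

theorem det_sylvester15 (h2 : (2 : A) = 0) (a b : A) (q : Polynomial A) :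
    (sylvester15 (Polynomial.C a * Polynomial.X + Polynomial.C b) q).det =
      ∑ i ∈ Finset.range 6, q.coeff i * b ^ i * a ^ (5 - i) := by
  have h : (sylvester15 (Polynomial.C a * Polynomial.X + Polynomial.C b) q) =
      !![a, b, 0, 0, 0, 0; 0, a, b, 0, 0, 0; 0, 0, a, b, 0, 0; 0, 0, 0, a, b, 0;
        0, 0, 0, 0, a, b; q.coeff 5, q.coeff 4, q.coeff 3, q.coeff 2, q.coeff 1, q.coeff 0] := by
    ext i j
    fin_cases i <;> fin_cases j <;> simp [sylvester15]
  have h' : (2 : A) * (q.coeff 1 * b * a ^ 4 + q.coeff 3 * b ^ 3 * a ^ 2 + q.coeff 5 * b ^ 5) = 0 :=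
    by rw [h2, zero_mul]
  rw [h]
  simp [Matrix.det_succ_row_zero, Fin.sum_univ_succ, Finset.sum_range_succ, Fin.succAbove]
  linear_combination -h'

end Resultant

section PlaneSections

variable {K : Type*} [Field K]

/-- The coefficient of `x₁^i x₂^j x₃^k` in `F(t x₁, s x₁, x₂, x₃) / x₁`. -/
noncomputable def planeCoeff {B : Type*} [CommRing B] [Algebra K B] (F : MvPolynomial (Fin 4) K)
    (t s : B) (i j k : ℕ) : B :=
  ∑ i₀ ∈ Finset.range (i + 2),
    algebraMap K B (coeff (expo i₀ (i + 1 - i₀) j k) F) * t ^ i₀ * s ^ (i + 1 - i₀)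

theorem map_planeCoeff {B B' : Type*} [CommRing B] [Algebra K B] [CommRing B'] [Algebra K B']
    (f : B →ₐ[K] B') (F : MvPolynomial (Fin 4) K) (t s : B) (i j k : ℕ) :
    f (planeCoeff F t s i j k) = planeCoeff F (f t) (f s) i j k := by
  simp [planeCoeff]

theorem planeCoeff_mul {B : Type*} [CommRing B] [Algebra K B] (F : MvPolynomial (Fin 4) K)
    (r t s : B) (i j k : ℕ) :
    planeCoeff F (r * t) (r * s) i j k = r ^ (i + 1) * planeCoeff F t s i j k := by
  rw [planeCoeff, planeCoeff, Finset.mul_sum]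
  refine Finset.sum_congr rfl fun m hm => ?_
  obtain ⟨n, hn⟩ := Nat.exists_eq_add_of_le (Nat.lt_succ_iff.mp (Finset.mem_range.mp hm))
  rw [hn, Nat.add_sub_cancel_left]
  ring

theorem aeval_eq_sum_expo {B : Type*} [CommRing B] [Algebra K B] {F : MvPolynomial (Fin 4) K}
    {n : ℕ} (hhom : F.IsHomogeneous n) (v : Fin 4 → B) :
    aeval v F = ∑ a ∈ Finset.range (n + 1), ∑ b ∈ Finset.range (n + 1 - a),
      ∑ c ∈ Finset.range (n + 1 - a - b),
        algebraMap K B (coeff (expo a b c (n - a - b - c)) F) *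
          (v 0 ^ a * v 1 ^ b * v 2 ^ c * v 3 ^ (n - a - b - c)) := by
  rw [aeval_def, eval₂_eq', Finset.sum_sigma', Finset.sum_sigma']
  have hexpo : ∀ d : Fin 4 →₀ ℕ, expo (d 0) (d 1) (d 2) (d 3) = d := fun d => by
    ext i; fin_cases i <;> simp [expo]
  have hdeg : ∀ d ∈ F.support, d 0 + d 1 + d 2 + d 3 = n := fun d hd => by
    have h := hhom (mem_support_iff.mp hd)
    rw [Finsupp.weight_apply, Finsupp.sum_fintype _ _ (by simp)] at h
    simpa [Fin.sum_univ_four] using h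
  refine Finset.sum_of_injOn (fun d => ⟨⟨d 0, d 1⟩, d 2⟩) ?_ ?_ ?_ ?_
  · intro d hd e he h
    simp only [Sigma.mk.injEq, heq_eq_eq] at h
    have h₃ : d 3 = e 3 := by have := hdeg d hd; have := hdeg e he; omega
    rw [← hexpo d, ← hexpo e, h.1.1, h.1.2, h.2, h₃]
  · intro d hd
    have := hdeg d hd
    simp only [Finset.coe_sigma, Set.mem_sigma_iff, Finset.mem_coe, Finset.mem_range]
    omega
  · rintro ⟨⟨a, b⟩, c⟩ hx hne
    simp only [Finset.mem_sigma, Finset.mem_range] at hx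
    by_cases h : coeff (expo a b c (n - a - b - c)) F = 0
    · simp [h]
    · exact absurd ⟨_, mem_support_iff.mpr h, by simp [expo]⟩ hne
  · intro d hd
    have h := hdeg d hd
    have h₃ : n - d 0 - d 1 - d 2 = d 3 := by omega
    simp only [h₃, hexpo, Fin.prod_univ_four]

variable {F : MvPolynomial (Fin 4) K}

theorem aeval_plane (hhom : F.IsHomogeneous 4)
    (hline : ∀ i₂ i₃ : ℕ, coeff (expo 0 0 i₂ i₃) F = 0) {B : Type*} [CommRing B] [Algebra K B]
    (t s x y z : B) :
    aeval ![t * x, s * x, y, z] F = x * cubicEval (planeCoeff F t s) x y z := by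
  rw [aeval_eq_sum_expo hhom]
  simp only [Finset.sum_range_succ, Finset.sum_range_zero, cubicEval, planeCoeff, hline,
    map_zero, zero_mul, zero_add, add_zero, Nat.reduceAdd, Nat.reduceSub, Matrix.cons_val]
  ring

theorem eval_pderiv_eq_zero (hhom : F.IsHomogeneous 4)
    (hline : ∀ i₂ i₃ : ℕ, coeff (expo 0 0 i₂ i₃) F = 0) (p₂ p₃ : K)
    (hα : cubicEval (planeCoeff F (1 : K) 0) 0 p₂ p₃ = 0)
    (hβ : cubicEval (planeCoeff F (0 : K) 1) 0 p₂ p₃ = 0) (i : Fin 4) :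
    eval (![0, 0, p₂, p₃] : Fin 4 → K) (pderiv i F) = 0 := by
  have h := aeval_eq_sum_expo hhom (X : Fin 4 → MvPolynomial (Fin 4) K)
  rw [aeval_X_left_apply] at h
  rw [h]
  simp only [cubicEval, planeCoeff, Finset.sum_range_succ, Finset.sum_range_zero] at hα hβ
  norm_num at hα hβ
  simp only [Finset.sum_range_succ, Finset.sum_range_zero, hline,
    map_zero, zero_mul, zero_add, add_zero, Nat.reduceAdd, Nat.reduceSub, Derivation.leibniz,
    map_add, Derivation.leibniz_pow, algebraMap_eq, pderiv_C]
  fin_cases i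
  · simp [pderiv_X]
    linear_combination hα
  · simp [pderiv_X]
    linear_combination hβ
  · simp [pderiv_X]
  · simp [pderiv_X]

theorem homogenizesTo_cc (F : MvPolynomial (Fin 4) K) (b a : MvPolynomial (Fin 2) K)
    (i j k : ℕ) :
    HomogenizesTo (i + 1) b a ((cc K F i j k).map (C : K →+* MvPolynomial (Fin 2) K))
      (planeCoeff F b a i j k) := by
  constructor
  · refine Polynomial.natDegree_map_le.trans (Polynomial.natDegree_sum_le_of_forall_le _ _ ?_)
    intro m hm
    exact (Polynomial.natDegree_C_mul_X_pow_le _ _).trans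
      (Nat.lt_succ_iff.mp (Finset.mem_range.mp hm))
  · rw [cc, Polynomial.map_sum, Polynomial.homogenize_finsetSum, map_sum, planeCoeff]
    refine Finset.sum_congr rfl fun m hm => ?_
    rw [Polynomial.map_mul, Polynomial.map_C, Polynomial.map_pow, Polynomial.map_X,
      Polynomial.homogenize_C_mul,
      Polynomial.homogenize_X_pow (Nat.lt_succ_iff.mp (Finset.mem_range.mp hm))]
    simp [mul_assoc, algebraMap_eq]

theorem homogenizesTo_hTilde (F : MvPolynomial (Fin 4) K) (b a : MvPolynomial (Fin 2) K) :
    HomogenizesTo 5 b a (hTilde K F) (cubicHess (planeCoeff F b a) (X 0) (X 1)) := by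
  have c := homogenizesTo_cc F b a
  have k := HomogenizesTo.const b a
  have m : ∀ {l₁ l₂ l₃ : ℕ} {p₁ p₂ p₃ : Polynomial (MvPolynomial (Fin 2) K)}
      {r₁ r₂ r₃ : MvPolynomial (Fin 2) K}, HomogenizesTo l₁ b a p₁ r₁ →
      HomogenizesTo l₂ b a p₂ r₂ → HomogenizesTo l₃ b a p₃ r₃ →
      l₁ + l₂ + l₃ = 5 → HomogenizesTo 5 b a (p₁ * p₂ * p₃) (r₁ * r₂ * r₃) :=
    fun h₁ h₂ h₃ hl => hl ▸ (h₁.mul h₂).mul h₃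
  have z₃ : HomogenizesTo 5 b a _ _ :=
    ((((m (c 0 0 3) (c 0 2 1) (c 2 0 1) rfl).add ((c 0 0 3).mul (c 1 1 1).sq)).add
      ((c 0 1 2).sq.mul (c 2 0 1))).add (m (c 0 1 2) (c 1 0 2) (c 1 1 1) rfl)).add
      ((c 0 2 1).mul (c 1 0 2).sq)
  have yz₂ : HomogenizesTo 5 b a _ _ :=
    (((((m (c 0 0 3) (c 0 2 1) (c 2 1 0) rfl).add (m (c 0 0 3) (c 0 3 0) (c 2 0 1) rfl)).add
      (m (c 0 0 3) (c 1 1 1) (c 1 2 0) rfl)).add ((c 0 1 2).sq.mul (c 2 1 0))).add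
      (m (c 0 1 2) (c 0 2 1) (c 2 0 1) rfl)).add ((c 0 3 0).mul (c 1 0 2).sq)
  have y₂z : HomogenizesTo 5 b a _ _ :=
    (((((m (c 0 0 3) (c 0 3 0) (c 2 1 0) rfl).add ((c 0 0 3).mul (c 1 2 0).sq)).add
      (m (c 0 1 2) (c 0 2 1) (c 2 1 0) rfl)).add (m (c 0 1 2) (c 0 3 0) (c 2 0 1) rfl)).add
      ((c 0 2 1).sq.mul (c 2 0 1))).add (m (c 0 3 0) (c 1 0 2) (c 1 1 1) rfl)
  have y₃ : HomogenizesTo 5 b a _ _ :=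
    ((((m (c 0 1 2) (c 0 3 0) (c 2 1 0) rfl).add ((c 0 1 2).mul (c 1 2 0).sq)).add
      ((c 0 2 1).sq.mul (c 2 1 0))).add (m (c 0 2 1) (c 1 1 1) (c 1 2 0) rfl)).add
      ((c 0 3 0).mul (c 1 1 1).sq)
  exact (((z₃.mul (k _)).add (yz₂.mul (k _))).add (y₂z.mul (k _))).add (y₃.mul (k _))

theorem alphaForm_eq (F : MvPolynomial (Fin 4) K) :
    alphaForm K F = cubicEval (planeCoeff F 1 0) 0 (X 0) (X 1) := by
  simp [alphaForm, cubicEval, planeCoeff, Finset.sum_range_succ, algebraMap_eq]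
  ring

theorem betaForm_eq (F : MvPolynomial (Fin 4) K) :
    betaForm K F = cubicEval (planeCoeff F 0 1) 0 (X 0) (X 1) := by
  simp [betaForm, cubicEval, planeCoeff, Finset.sum_range_succ, algebraMap_eq]
  ring

theorem cubicEval_planeCoeff_zero {B : Type*} [CommRing B] [Algebra K B]
    (F : MvPolynomial (Fin 4) K) (t s y z : B) :
    cubicEval (planeCoeff F t s) 0 y z =
      t * cubicEval (planeCoeff F 1 0) 0 y z + s * cubicEval (planeCoeff F 0 1) 0 y z := by
  simp [cubicEval, planeCoeff, Finset.sum_range_succ]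
  ring

end PlaneSections

theorem exists_mul_add_mul_eq_one {K : Type*} [Field K] {t s : K} (h : ¬(t = 0 ∧ s = 0)) :
    ∃ u v : K, u * t + v * s = 1 := by
  by_cases ht : t = 0
  · exact ⟨0, s⁻¹, by rw [inv_mul_cancel₀ fun hs => h ⟨ht, hs⟩]; simp⟩
  · exact ⟨t⁻¹, 0, by rw [inv_mul_cancel₀ ht]; simp⟩

section LocalRoots

variable {K : Type*} [Field K]

theorem map_cubicSubst_planeCoeff {A B : Type*} [CommRing A] [Algebra K A] [CommRing B]
    [Algebra K B] (f : A →ₐ[K] B) (F : MvPolynomial (Fin 4) K) {t s u v : K}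
    (huv : u * t + v * s = 1) {b a : A} (hf : f (algebraMap K A s * b - algebraMap K A t * a) = 0)
    (q₂ q₃ p₂ p₃ : K) (i j k : ℕ) :
    f (cubicSubst (planeCoeff F b a) (algebraMap K A q₂) (algebraMap K A q₃) (algebraMap K A p₂)
        (algebraMap K A p₃) i j k) =
      f ((algebraMap K A u * b + algebraMap K A v * a) ^ (i + 1) *
        algebraMap K A (cubicSubst (planeCoeff F t s) q₂ q₃ p₂ p₃ i j k)) := by
  have huv' : algebraMap K B u * algebraMap K B t + algebraMap K B v * algebraMap K B s = 1 := by
    rw [← map_mul, ← map_mul, ← map_add, huv, map_one]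
  simp only [map_sub, map_mul, AlgHom.commutes] at hf
  have hb : f b = f (algebraMap K A u * b + algebraMap K A v * a) * algebraMap K B t := by
    simp only [map_add, map_mul, AlgHom.commutes]
    linear_combination algebraMap K B v * hf - f b * huv'
  have ha : f a = f (algebraMap K A u * b + algebraMap K A v * a) * algebraMap K B s := by
    simp only [map_add, map_mul, AlgHom.commutes]
    linear_combination - algebraMap K B u * hf - f a * huv'
  rw [map_mul, map_pow, AlgHom.commutes, map_cubicSubst (algebraMap K B), ← cubicSubst_weighted,
    ← AlgHom.coe_toRingHom, map_cubicSubst, AlgHom.coe_toRingHom]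
  simp only [AlgHom.commutes, map_planeCoeff]
  rw [hb, ha]
  simp only [planeCoeff_mul]
  congr 1
  ext i j k
  exact congrArg _ (map_planeCoeff (Algebra.ofId K B) F t s i j k).symm

theorem prime_linearForm {p₂ p₃ : K} (hp : ¬(p₂ = 0 ∧ p₃ = 0)) :
    Prime (C p₃ * X 0 - C p₂ * X 1 : MvPolynomial (Fin 2) K) := by
  have h : (C p₃ * X 0 - C p₂ * X 1 : MvPolynomial (Fin 2) K) =
      sumSMulX (Finsupp.equivFunOnFinite.symm ![p₃, -p₂]) := by
    rw [sumSMulX, Finsupp.linearCombination_apply, Finsupp.sum_fintype _ _ (by simp)]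
    simp [Fin.sum_univ_two, smul_eq_C_mul, sub_eq_add_neg]
  rw [h]
  refine (irreducible_sumSMulX _ ?_ ?_).prime
  · rw [Finsupp.support_nonempty_iff]
    intro h0
    exact hp ⟨by simpa using DFunLike.congr_fun h0 1, by simpa using DFunLike.congr_fun h0 0⟩
  · intro r hr
    rw [isUnit_iff_ne_zero]
    rintro rfl
    exact hp ⟨by simpa using hr 1, by simpa using hr 0⟩

theorem gam_pow_mul_lineResultant [CharP K 2] {F : MvPolynomial (Fin 4) K}
    {gam alphaRed betaRed : MvPolynomial (Fin 2) K}
    (hfacα : alphaForm K F = gam * alphaRed) (hfacβ : betaForm K F = gam * betaRed) :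
    gam ^ 5 * lineResultant K F alphaRed betaRed =
      cubicHess (planeCoeff F (betaForm K F) (alphaForm K F)) (X 0) (X 1) := by
  rw [lineResultant, det_sylvester15 (CharTwo.two_eq_zero),
    ← (homogenizesTo_hTilde F (betaForm K F) (alphaForm K F)).sum_coeff, hfacα, hfacβ,
    Finset.mul_sum]
  simp only [Finset.sum_range_succ, Finset.sum_range_zero]
  ring

theorem pow_dvd_lineResultant [CharP K 2] {F : MvPolynomial (Fin 4) K}
    {gam alphaRed betaRed : MvPolynomial (Fin 2) K}
    (hfacα : alphaForm K F = gam * alphaRed) (hfacβ : betaForm K F = gam * betaRed)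
    {p₂ p₃ q₂ q₃ : K} (hq : q₂ * p₃ - q₃ * p₂ = 1)
    (hgam : eval ![p₂, p₃] gam ≠ 0) (n : ℕ)
    (h : (C p₃ * X 0 - C p₂ * X 1 : MvPolynomial (Fin 2) K) ^ n ∣
      cubicHess (cubicSubst (planeCoeff F (betaForm K F) (alphaForm K F)) (C q₂) (C q₃) (C p₂)
        (C p₃)) (C p₃ * X 0 - C p₂ * X 1) (C q₂ * X 1 - C q₃ * X 0)) :
    (C p₃ * X 0 - C p₂ * X 1 : MvPolynomial (Fin 2) K) ^ n ∣
      lineResultant K F alphaRed betaRed := by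
  have h2 : (2 : MvPolynomial (Fin 2) K) = 0 := CharTwo.two_eq_zero
  have hq' : (C q₂ * C p₃ - C q₃ * C p₂ : MvPolynomial (Fin 2) K) = 1 := by
    rw [← C_mul, ← C_mul, ← C_sub, hq, C_1]
  have hx₀ : C q₂ * (C p₃ * X 0 - C p₂ * X 1) + C p₂ * (C q₂ * X 1 - C q₃ * X 0) =
      (X 0 : MvPolynomial (Fin 2) K) := by linear_combination X 0 * hq'
  have hx₁ : C q₃ * (C p₃ * X 0 - C p₂ * X 1) + C p₃ * (C q₂ * X 1 - C q₃ * X 0) =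
      (X 1 : MvPolynomial (Fin 2) K) := by linear_combination X 1 * hq'
  have hprime : Prime (C p₃ * X 0 - C p₂ * X 1 : MvPolynomial (Fin 2) K) := by
    refine prime_linearForm ?_
    rintro ⟨rfl, rfl⟩
    simp at hq
  refine hprime.pow_dvd_of_dvd_mul_left n (a := gam ^ 5) ?_ ?_
  · intro hdvd
    obtain ⟨w, hw⟩ := hprime.dvd_of_dvd_pow hdvd
    refine hgam ?_
    rw [hw]
    simp [mul_comm]
  · rw [gam_pow_mul_lineResultant hfacα hfacβ]
    rw [← cubicHess_subst h2 _ _ _ _ _ _ _ hq', hx₀, hx₁] at h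
    · exact h
    · rw [hx₀, hx₁, cubicEval_planeCoeff_zero, ← alphaForm_eq, ← betaForm_eq]
      linear_combination alphaForm K F * betaForm K F * h2

/-- The linear equation satisfied by the tangent planes along the line, in coordinates adapted
to a point of the line. -/
theorem tangent_eq [CharP K 2] (F : MvPolynomial (Fin 4) K) {t s p₂ p₃ q₂ q₃ : K}
    (hq : q₂ * p₃ - q₃ * p₂ = 1) :
    C s * betaForm K F - C t * alphaForm K F =
      cubicEval (fun i j k => C (cubicSubst (planeCoeff F t s) q₂ q₃ p₂ p₃ i j k)) 0
        (C p₃ * X 0 - C p₂ * X 1) (C q₂ * X 1 - C q₃ * X 0) := by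
  have h2 : (2 : MvPolynomial (Fin 2) K) = 0 := CharTwo.two_eq_zero
  have hq' : (C q₂ * C p₃ - C q₃ * C p₂ : MvPolynomial (Fin 2) K) = 1 := by
    rw [← C_mul, ← C_mul, ← C_sub, hq, C_1]
  have hx₀ : C q₂ * (C p₃ * X 0 - C p₂ * X 1) + C p₂ * (C q₂ * X 1 - C q₃ * X 0) =
      (X 0 : MvPolynomial (Fin 2) K) := by linear_combination X 0 * hq'
  have hx₁ : C q₃ * (C p₃ * X 0 - C p₂ * X 1) + C p₃ * (C q₂ * X 1 - C q₃ * X 0) =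
      (X 1 : MvPolynomial (Fin 2) K) := by linear_combination X 1 * hq'
  have hc : (fun i j k => (C (planeCoeff F t s i j k) : MvPolynomial (Fin 2) K)) =
      planeCoeff F (C t) (C s) := by
    ext1 i; ext1 j; ext1 k
    exact map_planeCoeff (Algebra.ofId K (MvPolynomial (Fin 2) K)) F t s i j k
  simp only [map_cubicSubst C, hc]
  rw [← cubicEval_subst, hx₀, hx₁, cubicEval_planeCoeff_zero, ← alphaForm_eq, ← betaForm_eq]
  linear_combination - C t * alphaForm K F * h2

section

variable [CharP K 2] {F : MvPolynomial (Fin 4) K} {gam alphaRed betaRed : MvPolynomial (Fin 2) K}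
    {t s p₂ p₃ q₂ q₃ : K}

theorem dvd_lineResultant
    (hfacα : alphaForm K F = gam * alphaRed) (hfacβ : betaForm K F = gam * betaRed)
    (hq : q₂ * p₃ - q₃ * p₂ = 1) (hgam : eval ![p₂, p₃] gam ≠ 0) (hts : ¬(t = 0 ∧ s = 0)) (a : K)
    (h₀ : cubicSubst (planeCoeff F t s) q₂ q₃ p₂ p₃ 0 0 3 = 0)
    (h₁ : cubicSubst (planeCoeff F t s) q₂ q₃ p₂ p₃ 1 0 2 +
      a * cubicSubst (planeCoeff F t s) q₂ q₃ p₂ p₃ 0 1 2 = 0)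
    (h₂ : cubicSubst (planeCoeff F t s) q₂ q₃ p₂ p₃ 2 0 1 +
      a * cubicSubst (planeCoeff F t s) q₂ q₃ p₂ p₃ 1 1 1 +
      a ^ 2 * cubicSubst (planeCoeff F t s) q₂ q₃ p₂ p₃ 0 2 1 = 0) :
    (C p₃ * X 0 - C p₂ * X 1 : MvPolynomial (Fin 2) K) ∣
      lineResultant K F alphaRed betaRed := by
  obtain ⟨u, v, huv⟩ := exists_mul_add_mul_eq_one hts
  have h := pow_dvd_lineResultant hfacα hfacβ hq hgam 1
  simp only [pow_one] at h
  refine h ?_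
  set L : MvPolynomial (Fin 2) K := C p₃ * X 0 - C p₂ * X 1 with hL
  let f := Ideal.Quotient.mkₐ K (Ideal.span {L})
  have hf : ∀ x, f x = 0 ↔ L ∣ x := fun x => by
    rw [← Ideal.mem_span_singleton]
    exact Ideal.Quotient.eq_zero_iff_mem
  rw [← hf]
  refine map_cubicHess_eq_zero CharTwo.two_eq_zero _
    (fun i j k => C (cubicSubst (planeCoeff F t s) q₂ q₃ p₂ p₃ i j k)) (C a)
    (C u * betaForm K F + C v * alphaForm K F) _ _ f.toRingHom ((hf L).mpr dvd_rfl)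
    (fun i j k => map_cubicSubst_planeCoeff f F huv ?_ q₂ q₃ p₂ p₃ i j k) (by simp [h₀])
    (by simp only [← C_mul, ← C_add, h₁, C_0])
    (by simp only [← C_mul, ← C_add, ← C_pow, h₂, C_0])
  rw [hf, algebraMap_eq, tangent_eq F hq]
  simp only [h₀, cubicEval]
  exact Dvd.intro (C (cubicSubst (planeCoeff F t s) q₂ q₃ p₂ p₃ 0 1 2) *
      (C q₂ * X 1 - C q₃ * X 0) ^ 2 + C (cubicSubst (planeCoeff F t s) q₂ q₃ p₂ p₃ 0 2 1) *
      (L * (C q₂ * X 1 - C q₃ * X 0)) + C (cubicSubst (planeCoeff F t s) q₂ q₃ p₂ p₃ 0 3 0) *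
      L ^ 2) (by rw [C_0]; ring)

/-- The coefficients which vanish in the tangent plane at a point of the line are divisible by
the equation of the tangent planes. -/
theorem dvd_cubicSubst (hq : q₂ * p₃ - q₃ * p₂ = 1) (hts : ¬(t = 0 ∧ s = 0)) {i j k : ℕ}
    {D : MvPolynomial (Fin 2) K}
    (hD : D ∣ cubicEval (fun i j k => C (cubicSubst (planeCoeff F t s) q₂ q₃ p₂ p₃ i j k)) 0
        (C p₃ * X 0 - C p₂ * X 1) (C q₂ * X 1 - C q₃ * X 0))
    (h : cubicSubst (planeCoeff F t s) q₂ q₃ p₂ p₃ i j k = 0) :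
    D ∣ cubicSubst (planeCoeff F (betaForm K F) (alphaForm K F)) (C q₂) (C q₃) (C p₂) (C p₃)
      i j k := by
  obtain ⟨u, v, huv⟩ := exists_mul_add_mul_eq_one hts
  let f := Ideal.Quotient.mkₐ K (Ideal.span {D})
  have hf : ∀ x, f x = 0 ↔ D ∣ x := fun x => by
    rw [← Ideal.mem_span_singleton]
    exact Ideal.Quotient.eq_zero_iff_mem
  rw [← tangent_eq F hq, ← hf] at hD
  rw [← hf]
  refine (map_cubicSubst_planeCoeff f F huv hD q₂ q₃ p₂ p₃ i j k).trans ?_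
  rw [h, map_zero, mul_zero, map_zero]

theorem sq_dvd_lineResultant
    (hfacα : alphaForm K F = gam * alphaRed) (hfacβ : betaForm K F = gam * betaRed)
    (hq : q₂ * p₃ - q₃ * p₂ = 1) (hgam : eval ![p₂, p₃] gam ≠ 0) (hts : ¬(t = 0 ∧ s = 0))
    (h₀ : cubicSubst (planeCoeff F t s) q₂ q₃ p₂ p₃ 0 0 3 = 0)
    (h₁ : cubicSubst (planeCoeff F t s) q₂ q₃ p₂ p₃ 0 1 2 = 0)
    (h₂ : cubicSubst (planeCoeff F t s) q₂ q₃ p₂ p₃ 1 0 2 = 0) :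
    (C p₃ * X 0 - C p₂ * X 1 : MvPolynomial (Fin 2) K) ^ 2 ∣
      lineResultant K F alphaRed betaRed := by
  have hD : (C p₃ * X 0 - C p₂ * X 1) ^ 2 ∣
      cubicEval (fun i j k => C (cubicSubst (planeCoeff F t s) q₂ q₃ p₂ p₃ i j k)) 0
        (C p₃ * X 0 - C p₂ * X 1 : MvPolynomial (Fin 2) K) (C q₂ * X 1 - C q₃ * X 0) := by
    simp only [cubicEval, h₀, h₁]
    exact Dvd.intro (C (cubicSubst (planeCoeff F t s) q₂ q₃ p₂ p₃ 0 2 1) *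
      (C q₂ * X 1 - C q₃ * X 0) + C (cubicSubst (planeCoeff F t s) q₂ q₃ p₂ p₃ 0 3 0) *
      (C p₃ * X 0 - C p₂ * X 1)) (by rw [C_0]; ring)
  exact pow_dvd_lineResultant hfacα hfacβ hq hgam 2 (sq_dvd_cubicHess _ _ _
    (dvd_cubicSubst hq hts hD h₀) (dvd_cubicSubst hq hts hD h₁) (dvd_cubicSubst hq hts hD h₂))

theorem pow_five_dvd_lineResultant
    (hfacα : alphaForm K F = gam * alphaRed) (hfacβ : betaForm K F = gam * betaRed)
    (hq : q₂ * p₃ - q₃ * p₂ = 1) (hgam : eval ![p₂, p₃] gam ≠ 0) (hts : ¬(t = 0 ∧ s = 0))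
    (h₀ : cubicSubst (planeCoeff F t s) q₂ q₃ p₂ p₃ 0 0 3 = 0)
    (h₁ : cubicSubst (planeCoeff F t s) q₂ q₃ p₂ p₃ 0 1 2 = 0)
    (h₂ : cubicSubst (planeCoeff F t s) q₂ q₃ p₂ p₃ 1 0 2 = 0)
    (h₃ : cubicSubst (planeCoeff F t s) q₂ q₃ p₂ p₃ 0 2 1 = 0)
    (h₄ : cubicSubst (planeCoeff F t s) q₂ q₃ p₂ p₃ 1 1 1 = 0)
    (h₅ : cubicSubst (planeCoeff F t s) q₂ q₃ p₂ p₃ 2 0 1 = 0) :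
    (C p₃ * X 0 - C p₂ * X 1 : MvPolynomial (Fin 2) K) ^ 5 ∣
      lineResultant K F alphaRed betaRed := by
  have hD : (C p₃ * X 0 - C p₂ * X 1) ^ 3 ∣
      cubicEval (fun i j k => C (cubicSubst (planeCoeff F t s) q₂ q₃ p₂ p₃ i j k)) 0
        (C p₃ * X 0 - C p₂ * X 1 : MvPolynomial (Fin 2) K) (C q₂ * X 1 - C q₃ * X 0) := by
    simp only [cubicEval, h₀, h₁, h₃]
    exact Dvd.intro (C (cubicSubst (planeCoeff F t s) q₂ q₃ p₂ p₃ 0 3 0)) (by rw [C_0]; ring)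
  exact pow_dvd_lineResultant hfacα hfacβ hq hgam 5 (pow_five_dvd_cubicHess _ _ _
    (dvd_cubicSubst hq hts hD h₀) (dvd_cubicSubst hq hts hD h₁) (dvd_cubicSubst hq hts hD h₂)
    (dvd_cubicSubst hq hts hD h₃) (dvd_cubicSubst hq hts hD h₄) (dvd_cubicSubst hq hts hD h₅))

end

end LocalRoots

section Contact

variable {K : Type*} [Field K]

/-- The parametrised line `P + x Q`. -/
noncomputable def pointLine (P Q : Fin 4 → K) (i : Fin 4) : Polynomial K :=
  Polynomial.C (Q i) * Polynomial.X + Polynomial.C (P i)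

theorem aeval_pointLine_eq_zero [Infinite K] {F : MvPolynomial (Fin 4) K}
    {W : Submodule K (Fin 4 → K)} (hW : ∀ v ∈ W, eval v F = 0) {P Q : Fin 4 → K} (hP : P ∈ W)
    (hQ : Q ∈ W) : aeval (pointLine P Q) F = 0 := by
  refine Polynomial.funext fun x => ?_
  have h : (Polynomial.aeval x).comp (aeval (pointLine P Q)) =
      aeval (x • Q + P) := by
    ext i
    simp only [AlgHom.comp_apply, aeval_X, pointLine, map_add, map_mul, Polynomial.aeval_C,
      Polynomial.aeval_X, Pi.add_apply, Pi.smul_apply, smul_eq_mul, Algebra.algebraMap_self_apply]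
    ring
  have h' := DFunLike.congr_fun h F
  rw [AlgHom.comp_apply, Polynomial.coe_aeval_eq_eval] at h'
  rw [h', Polynomial.eval_zero]
  exact (RingHom.congr_fun (coe_aeval_eq_eval _) F).trans
    (hW _ (W.add_mem (W.smul_mem x hQ) hP))

theorem X_dvd_aeval_pointLine {lin : MvPolynomial (Fin 4) K} {P : Fin 4 → K}
    (h : eval P lin = 0) (Q : Fin 4 → K) : Polynomial.X ∣ aeval (pointLine P Q) lin := by
  rw [Polynomial.X_dvd_iff, Polynomial.coeff_zero_eq_eval_zero, ← Polynomial.coe_aeval_eq_eval,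
    ← AlgHom.comp_apply]
  have h' : (Polynomial.aeval (0 : K)).comp (aeval (pointLine P Q)) = aeval P := by
    ext i
    simp [pointLine]
  rw [h']
  exact (RingHom.congr_fun (coe_aeval_eq_eval P) lin).trans h

variable {F : MvPolynomial (Fin 4) K}

theorem aeval_pointLine (hhom : F.IsHomogeneous 4)
    (hline : ∀ i₂ i₃ : ℕ, coeff (expo 0 0 i₂ i₃) F = 0) (p₂ p₃ : K) (Q : Fin 4 → K) :
    aeval (pointLine ![0, 0, p₂, p₃] Q) F = Polynomial.X *
      cubicEval (fun i j k => Polynomial.C (planeCoeff F (Q 0) (Q 1) i j k)) Polynomial.X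
        (Polynomial.C (Q 2) * Polynomial.X + Polynomial.C p₂)
        (Polynomial.C (Q 3) * Polynomial.X + Polynomial.C p₃) := by
  have hc : (fun i j k => Polynomial.C (planeCoeff F (Q 0) (Q 1) i j k)) =
      planeCoeff F (Polynomial.C (Q 0)) (Polynomial.C (Q 1)) := by
    ext1 i; ext1 j; ext1 k
    exact map_planeCoeff (Algebra.ofId K (Polynomial K)) F (Q 0) (Q 1) i j k
  rw [hc, ← aeval_plane hhom hline]
  congr 2
  ext1 i
  fin_cases i <;> simp [pointLine]

theorem cubicEval_eq_zero_of_X_sq_dvd (hhom : F.IsHomogeneous 4)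
    (hline : ∀ i₂ i₃ : ℕ, coeff (expo 0 0 i₂ i₃) F = 0) {p₂ p₃ : K} {Q : Fin 4 → K}
    (h : Polynomial.X ^ 2 ∣ aeval (pointLine ![0, 0, p₂, p₃] Q) F) :
    cubicEval (planeCoeff F (Q 0) (Q 1)) 0 p₂ p₃ = 0 := by
  rw [aeval_pointLine hhom hline, sq, mul_dvd_mul_iff_left Polynomial.X_ne_zero,
    Polynomial.X_dvd_iff, Polynomial.coeff_zero_eq_eval_zero] at h
  simpa [cubicEval] using h

theorem aeval_pointLine_adapted (hhom : F.IsHomogeneous 4)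
    (hline : ∀ i₂ i₃ : ℕ, coeff (expo 0 0 i₂ i₃) F = 0) (t s p₂ p₃ q₂ q₃ a : K) (d : ℕ → ℕ → ℕ → K)
    (hd : cubicSubst (planeCoeff F t s) q₂ q₃ p₂ p₃ = d) :
    aeval (pointLine ![0, 0, p₂, p₃] ![t, s, a * q₂, a * q₃]) F = Polynomial.X *
      (Polynomial.C (d 0 0 3) + Polynomial.X * (Polynomial.C (d 1 0 2 + a * d 0 1 2) +
        Polynomial.X * (Polynomial.C (d 2 0 1 + a * d 1 1 1 + a ^ 2 * d 0 2 1) +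
          Polynomial.X * Polynomial.C (d 3 0 0 + a * d 2 1 0 + a ^ 2 * d 1 2 0 +
            a ^ 3 * d 0 3 0)))) := by
  have h := cubicEval_subst (fun i j k => Polynomial.C (planeCoeff F t s i j k))
    (Polynomial.C q₂) (Polynomial.C q₃) (Polynomial.C p₂) (Polynomial.C p₃) Polynomial.X
    (Polynomial.C a * Polynomial.X) 1
  have h' : cubicSubst (fun i j k => Polynomial.C (planeCoeff F t s i j k))
      (Polynomial.C q₂) (Polynomial.C q₃) (Polynomial.C p₂) (Polynomial.C p₃) =
      fun i j k => Polynomial.C (d i j k) := by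
    ext1 i; ext1 j; ext1 k
    rw [← hd, map_cubicSubst Polynomial.C]
  rw [h', mul_one, mul_one, ← mul_assoc, ← mul_assoc, ← map_mul, ← map_mul, mul_comm q₂,
    mul_comm q₃] at h
  rw [aeval_pointLine hhom hline]
  refine congrArg _ (h.trans ?_)
  simp only [cubicEval, map_add, map_mul, map_pow]
  ring

theorem of_X_pow_three_dvd (hhom : F.IsHomogeneous 4)
    (hline : ∀ i₂ i₃ : ℕ, coeff (expo 0 0 i₂ i₃) F = 0) {t s p₂ p₃ q₂ q₃ a : K}
    (h : Polynomial.X ^ 3 ∣ aeval (pointLine ![0, 0, p₂, p₃] ![t, s, a * q₂, a * q₃]) F) :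
    cubicSubst (planeCoeff F t s) q₂ q₃ p₂ p₃ 1 0 2 +
      a * cubicSubst (planeCoeff F t s) q₂ q₃ p₂ p₃ 0 1 2 = 0 := by
  rw [aeval_pointLine_adapted hhom hline t s p₂ p₃ q₂ q₃ a _ rfl, Polynomial.X_pow_dvd_iff] at h
  simpa using h 2 (by norm_num)

theorem of_X_pow_four_dvd (hhom : F.IsHomogeneous 4)
    (hline : ∀ i₂ i₃ : ℕ, coeff (expo 0 0 i₂ i₃) F = 0) {t s p₂ p₃ q₂ q₃ a : K}
    (h : Polynomial.X ^ 4 ∣ aeval (pointLine ![0, 0, p₂, p₃] ![t, s, a * q₂, a * q₃]) F) :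
    cubicSubst (planeCoeff F t s) q₂ q₃ p₂ p₃ 2 0 1 +
      a * cubicSubst (planeCoeff F t s) q₂ q₃ p₂ p₃ 1 1 1 +
      a ^ 2 * cubicSubst (planeCoeff F t s) q₂ q₃ p₂ p₃ 0 2 1 = 0 := by
  rw [aeval_pointLine_adapted hhom hline t s p₂ p₃ q₂ q₃ a _ rfl, Polynomial.X_pow_dvd_iff] at h
  simpa [Polynomial.coeff_zero_eq_eval_zero] using h 3 (by norm_num)

theorem exists_notMem_ell {W : Submodule K (Fin 4 → K)} (hW : Module.finrank K W = 2)
    (hne : W ≠ ell K) : ∃ Q ∈ W, ¬(Q 0 = 0 ∧ Q 1 = 0) := by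
  by_contra! h
  refine hne (Submodule.eq_of_le_of_finrank_le (fun Q hQ => ?_) ?_)
  · obtain ⟨h₀, h₁⟩ := h Q hQ
    refine Submodule.mem_span_pair.mpr ⟨Q 2, Q 3, ?_⟩
    ext i
    fin_cases i <;> simp [h₀, h₁]
  · rw [hW]
    have h : ell K = Submodule.span K (Set.range ![![0, 0, 1, 0], ![0, 0, 0, 1]]) := by
      rw [ell, Set.pair_comm]
      simp [Matrix.range_cons, Matrix.range_empty]
    rw [h]
    exact finrank_range_le_card _

theorem exists_mem_of_line [Infinite K] [CharP K 2] (hhom : F.IsHomogeneous 4)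
    (hline : ∀ i₂ i₃ : ℕ, coeff (expo 0 0 i₂ i₃) F = 0) {t s p₂ p₃ q₂ q₃ : K}
    (hq : q₂ * p₃ - q₃ * p₂ = 1) (hts : ¬(t = 0 ∧ s = 0))
    (hs : cubicEval (planeCoeff F (1 : K) 0) 0 p₂ p₃ = s)
    (ht : cubicEval (planeCoeff F (0 : K) 1) 0 p₂ p₃ = t)
    {W : Submodule K (Fin 4 → K)} (hW : Module.finrank K W = 2) (hWF : ∀ v ∈ W, eval v F = 0)
    (hne : W ≠ ell K) (hP : ![0, 0, p₂, p₃] ∈ W) : ∃ a, ![t, s, a * q₂, a * q₃] ∈ W := by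
  obtain ⟨Q, hQ, hQ01⟩ := exists_notMem_ell hW hne
  have h := cubicEval_eq_zero_of_X_sq_dvd hhom hline (p₂ := p₂) (p₃ := p₃) (Q := Q)
    (by rw [aeval_pointLine_eq_zero hWF hP hQ]; exact dvd_zero _)
  rw [cubicEval_planeCoeff_zero, hs, ht] at h
  obtain ⟨u, v, huv⟩ := exists_mul_add_mul_eq_one hts
  have h2 : (2 : K) = 0 := CharTwo.two_eq_zero
  have h₀ : Q 0 = (u * Q 0 + v * Q 1) * t := by
    linear_combination -Q 0 * huv + v * h - v * Q 1 * t * h2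
  have h₁ : Q 1 = (u * Q 0 + v * Q 1) * s := by
    linear_combination -Q 1 * huv + u * h - u * Q 0 * s * h2
  set c := u * Q 0 + v * Q 1 with hc
  have hc0 : c ≠ 0 := fun h0 => hQ01 ⟨by rw [h₀, h0, zero_mul], by rw [h₁, h0, zero_mul]⟩
  refine ⟨c⁻¹ * (p₃ * Q 2 - p₂ * Q 3), ?_⟩
  convert W.sub_mem (W.smul_mem c⁻¹ hQ) (W.smul_mem (c⁻¹ * (q₂ * Q 3 - q₃ * Q 2)) hP) using 1
  ext i
  fin_cases i
  · simp [h₀, hc0]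
  · simp [h₁, hc0]
  · simp
    linear_combination c⁻¹ * Q 2 * hq
  · simp
    linear_combination c⁻¹ * Q 3 * hq

theorem eq_span_pair {t s p₂ p₃ : K} (hp : ¬(p₂ = 0 ∧ p₃ = 0)) (hts : ¬(t = 0 ∧ s = 0)) {y z : K}
    {W : Submodule K (Fin 4 → K)} (hW : Module.finrank K W = 2) (hP : ![0, 0, p₂, p₃] ∈ W)
    (hQ : ![t, s, y, z] ∈ W) :
    Submodule.span K (Set.range ![![0, 0, p₂, p₃], ![t, s, y, z]]) = W := by
  have hli : LinearIndependent K ![![0, 0, p₂, p₃], ![t, s, y, z]] := by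
    rw [LinearIndependent.pair_iff]
    intro c d h
    have e : ∀ i, c * (![0, 0, p₂, p₃] : Fin 4 → K) i + d * (![t, s, y, z] : Fin 4 → K) i = 0 :=
      fun i => congrFun h i
    have e₀ := e 0
    have e₁ := e 1
    have e₂ := e 2
    have e₃ := e 3
    simp only [Matrix.cons_val, mul_zero, zero_add, mul_eq_zero] at e₀ e₁ e₂ e₃
    have hd : d = 0 := by tauto
    simp only [hd, zero_mul, add_zero, mul_eq_zero] at e₂ e₃
    tauto
  refine Submodule.eq_of_le_of_finrank_le ?_ ?_
  · rw [Submodule.span_le]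
    rintro _ ⟨i, rfl⟩
    fin_cases i
    · exact hP
    · exact hQ
  · rw [hW, finrank_span_eq_card hli]
    simp

theorem X_mul_dvd_aeval_pointLine {t c : K} {g : MvPolynomial (Fin 4) K}
    (hg : bind₁ (fun i : Fin 4 => if i = 0 then C t * X 1 else X i) F = X 1 * g)
    (p₂ p₃ y z : K) {n : ℕ}
    (h : Polynomial.X ^ n ∣ aeval (pointLine ![0, 0, p₂, p₃] ![0, c, y, z]) g) :
    Polynomial.X ^ (n + 1) ∣ aeval (pointLine ![0, 0, p₂, p₃] ![c * t, c, y, z]) F := by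
  have e := congrArg (aeval (pointLine ![0, 0, p₂, p₃] ![0, c, y, z])) hg
  rw [aeval_bind₁, map_mul, aeval_X] at e
  have e' : (fun i : Fin 4 => aeval (pointLine ![0, 0, p₂, p₃] ![0, c, y, z])
      (if i = 0 then C t * X 1 else X i : MvPolynomial (Fin 4) K)) =
      pointLine ![0, 0, p₂, p₃] ![c * t, c, y, z] := by
    ext1 i
    fin_cases i <;> simp [pointLine, Polynomial.algebraMap_eq]
    ring
  rw [e'] at e
  rw [e, pow_succ']
  exact mul_dvd_mul (by simp [pointLine]) h

theorem tangent_of_residual (hhom : F.IsHomogeneous 4)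
    (hline : ∀ i₂ i₃ : ℕ, coeff (expo 0 0 i₂ i₃) F = 0) {t p₂ p₃ : K} {g : MvPolynomial (Fin 4) K}
    (hg : bind₁ (fun i : Fin 4 => if i = 0 then C t * X 1 else X i) F = X 1 * g)
    (hP : eval ![0, 0, p₂, p₃] g = 0) :
    t * cubicEval (planeCoeff F (1 : K) 0) 0 p₂ p₃ +
      cubicEval (planeCoeff F (0 : K) 1) 0 p₂ p₃ = 0 := by
  have h := X_mul_dvd_aeval_pointLine hg p₂ p₃ 0 0 (n := 1) (c := 1)
    (by rw [pow_one]; exact X_dvd_aeval_pointLine hP _)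
  have h' := cubicEval_eq_zero_of_X_sq_dvd hhom hline h
  rw [cubicEval_planeCoeff_zero] at h'
  simpa using h'

theorem eq_zero_of_linear {x y a b : K} (hab : a ≠ b) (ha : x + a * y = 0) (hb : x + b * y = 0) :
    x = 0 ∧ y = 0 := by
  have hy : y = 0 := by
    refine (mul_eq_zero.mp ?_).resolve_left (sub_ne_zero.mpr hab)
    linear_combination ha - hb
  exact ⟨by simpa [hy] using ha, hy⟩

theorem eq_zero_of_quadratic {x y z a b c : K} (hab : a ≠ b) (hac : a ≠ c) (hbc : b ≠ c)
    (ha : x + a * y + a ^ 2 * z = 0) (hb : x + b * y + b ^ 2 * z = 0)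
    (hc : x + c * y + c ^ 2 * z = 0) : x = 0 ∧ y = 0 ∧ z = 0 := by
  have h : ∀ {d : K}, a ≠ d → x + d * y + d ^ 2 * z = 0 → (y + a * z) + d * z = 0 := by
    intro d had hd
    refine (mul_eq_zero.mp ?_).resolve_left (sub_ne_zero.mpr had)
    linear_combination ha - hd
  obtain ⟨hy, hz⟩ := eq_zero_of_linear hbc (h hab hb) (h hac hc)
  have hy' : y = 0 := by simpa [hz] using hy
  exact ⟨by simpa [hz, hy'] using ha, hy', hz⟩

end Contact

section Multiplicity

variable {K : Type*} [Field K] [CharP K 2] {F : MvPolynomial (Fin 4) K}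
    {gam alphaRed betaRed : MvPolynomial (Fin 2) K} {t s p₂ p₃ q₂ q₃ : K}

theorem sq_dvd_lineResultant_of_two (hhom : F.IsHomogeneous 4)
    (hline : ∀ i₂ i₃ : ℕ, coeff (expo 0 0 i₂ i₃) F = 0)
    (hfacα : alphaForm K F = gam * alphaRed) (hfacβ : betaForm K F = gam * betaRed)
    (hq : q₂ * p₃ - q₃ * p₂ = 1) (hgam : eval ![p₂, p₃] gam ≠ 0) (hts : ¬(t = 0 ∧ s = 0))
    (h₀ : cubicSubst (planeCoeff F t s) q₂ q₃ p₂ p₃ 0 0 3 = 0) {a b : K} (hab : a ≠ b)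
    (ha : Polynomial.X ^ 3 ∣ aeval (pointLine ![0, 0, p₂, p₃] ![t, s, a * q₂, a * q₃]) F)
    (hb : Polynomial.X ^ 3 ∣ aeval (pointLine ![0, 0, p₂, p₃] ![t, s, b * q₂, b * q₃]) F) :
    (C p₃ * X 0 - C p₂ * X 1 : MvPolynomial (Fin 2) K) ^ 2 ∣
      lineResultant K F alphaRed betaRed := by
  obtain ⟨h₂, h₁⟩ := eq_zero_of_linear hab (of_X_pow_three_dvd hhom hline ha)
    (of_X_pow_three_dvd hhom hline hb)
  exact sq_dvd_lineResultant hfacα hfacβ hq hgam hts h₀ h₁ h₂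

theorem pow_five_dvd_lineResultant_of_three (hhom : F.IsHomogeneous 4)
    (hline : ∀ i₂ i₃ : ℕ, coeff (expo 0 0 i₂ i₃) F = 0)
    (hfacα : alphaForm K F = gam * alphaRed) (hfacβ : betaForm K F = gam * betaRed)
    (hq : q₂ * p₃ - q₃ * p₂ = 1) (hgam : eval ![p₂, p₃] gam ≠ 0) (hts : ¬(t = 0 ∧ s = 0))
    (h₀ : cubicSubst (planeCoeff F t s) q₂ q₃ p₂ p₃ 0 0 3 = 0) {a b c : K} (hab : a ≠ b)
    (hac : a ≠ c) (hbc : b ≠ c)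
    (ha : Polynomial.X ^ 4 ∣ aeval (pointLine ![0, 0, p₂, p₃] ![t, s, a * q₂, a * q₃]) F)
    (hb : Polynomial.X ^ 4 ∣ aeval (pointLine ![0, 0, p₂, p₃] ![t, s, b * q₂, b * q₃]) F)
    (hc : Polynomial.X ^ 4 ∣ aeval (pointLine ![0, 0, p₂, p₃] ![t, s, c * q₂, c * q₃]) F) :
    (C p₃ * X 0 - C p₂ * X 1 : MvPolynomial (Fin 2) K) ^ 5 ∣
      lineResultant K F alphaRed betaRed := by
  have h34 : (Polynomial.X ^ 3 : Polynomial K) ∣ Polynomial.X ^ 4 := pow_dvd_pow _ (by norm_num)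
  obtain ⟨h₂, h₁⟩ := eq_zero_of_linear hab (of_X_pow_three_dvd hhom hline (h34.trans ha))
    (of_X_pow_three_dvd hhom hline (h34.trans hb))
  obtain ⟨h₅, h₄, h₃⟩ := eq_zero_of_quadratic hab hac hbc (of_X_pow_four_dvd hhom hline ha)
    (of_X_pow_four_dvd hhom hline hb) (of_X_pow_four_dvd hhom hline hc)
  exact pow_five_dvd_lineResultant hfacα hfacβ hq hgam hts h₀ h₁ h₂ h₃ h₄ h₅

end Multiplicity

/-- Lemma 2.11 of the paper.  Let `F` be a quartic form in
characteristic 2 containing the line `ℓ : x₀ = x₁ = 0`, of positive degree `d`, with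
`α = γ·α̃`, `β = γ·β̃`, `γ = gcd(α,β)` (encoded by relative primality of `α̃,β̃`), and
let `R(ℓ) = Res_t(t·α̃+β̃, h̃)`.  (a) If a line on `X` distinct from `ℓ` meets `ℓ` at a
smooth point `P = [0:0:p₂:p₃]` of `X`, then `p₃x₂ − p₂x₃` divides `R(ℓ)`.  (b) If two
distinct such lines meet `ℓ` at `P`, or some residual cubic `E_t` has a linear
component of multiplicity ≥ 2 through `P`, then `(p₃x₂ − p₂x₃)²` divides `R(ℓ)`.
(c) If three distinct such lines meet `ℓ` at `P`, or some residual cubic factors as a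
double line through `P` times a further line through `P` (in particular a triple
line), then `(p₃x₂ − p₂x₃)⁵` divides `R(ℓ)`. -/
theorem line_resultant_local_roots
    (K : Type*) [Field K] [IsAlgClosed K] [CharP K 2]
    (F : MvPolynomial (Fin 4) K) (hF0 : F ≠ 0) (hhom : F.IsHomogeneous 4)
    (hline : ∀ i₂ i₃ : ℕ, coeff (expo 0 0 i₂ i₃) F = 0)
    (gam alphaRed betaRed : MvPolynomial (Fin 2) K)
    (hfacα : alphaForm K F = gam * alphaRed) (hfacβ : betaForm K F = gam * betaRed)
    (hcop : IsRelPrime alphaRed betaRed)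
    (hd : 1 ≤ max alphaRed.totalDegree betaRed.totalDegree)
    (p₂ p₃ : K) (hp : ¬(p₂ = 0 ∧ p₃ = 0))
    (hPsmooth : ∃ i : Fin 4, eval (![0, 0, p₂, p₃] : Fin 4 → K) (pderiv i F) ≠ 0) :
    ((∃ W : Submodule K (Fin 4 → K), Module.finrank K W = 2 ∧
        (∀ v ∈ W, eval v F = 0) ∧ W ≠ ell K ∧ (![0, 0, p₂, p₃] : Fin 4 → K) ∈ W) →
      (C p₃ * X 0 - C p₂ * X 1 : MvPolynomial (Fin 2) K) ∣
        lineResultant K F alphaRed betaRed) ∧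
    (((∃ W₁ W₂ : Submodule K (Fin 4 → K), W₁ ≠ W₂ ∧
        (Module.finrank K W₁ = 2 ∧ (∀ v ∈ W₁, eval v F = 0) ∧ W₁ ≠ ell K ∧
          (![0, 0, p₂, p₃] : Fin 4 → K) ∈ W₁) ∧
        (Module.finrank K W₂ = 2 ∧ (∀ v ∈ W₂, eval v F = 0) ∧ W₂ ≠ ell K ∧
          (![0, 0, p₂, p₃] : Fin 4 → K) ∈ W₂)) ∨
      (∃ t : K, ∃ g lin : MvPolynomial (Fin 4) K,
        bind₁ (fun i : Fin 4 => if i = 0 then C t * X 1 else X i) F = X 1 * g ∧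
        lin.IsHomogeneous 1 ∧ lin ≠ 0 ∧
        eval (![0, 0, p₂, p₃] : Fin 4 → K) lin = 0 ∧ lin ^ 2 ∣ g)) →
      (C p₃ * X 0 - C p₂ * X 1 : MvPolynomial (Fin 2) K) ^ 2 ∣
        lineResultant K F alphaRed betaRed) ∧
    (((∃ W₁ W₂ W₃ : Submodule K (Fin 4 → K), W₁ ≠ W₂ ∧ W₁ ≠ W₃ ∧ W₂ ≠ W₃ ∧
        (Module.finrank K W₁ = 2 ∧ (∀ v ∈ W₁, eval v F = 0) ∧ W₁ ≠ ell K ∧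
          (![0, 0, p₂, p₃] : Fin 4 → K) ∈ W₁) ∧
        (Module.finrank K W₂ = 2 ∧ (∀ v ∈ W₂, eval v F = 0) ∧ W₂ ≠ ell K ∧
          (![0, 0, p₂, p₃] : Fin 4 → K) ∈ W₂) ∧
        (Module.finrank K W₃ = 2 ∧ (∀ v ∈ W₃, eval v F = 0) ∧ W₃ ≠ ell K ∧
          (![0, 0, p₂, p₃] : Fin 4 → K) ∈ W₃)) ∨
      (∃ t : K, ∃ g lin₁ lin₂ : MvPolynomial (Fin 4) K,
        bind₁ (fun i : Fin 4 => if i = 0 then C t * X 1 else X i) F = X 1 * g ∧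
        lin₁.IsHomogeneous 1 ∧ lin₁ ≠ 0 ∧ lin₂.IsHomogeneous 1 ∧ lin₂ ≠ 0 ∧
        eval (![0, 0, p₂, p₃] : Fin 4 → K) lin₁ = 0 ∧
        eval (![0, 0, p₂, p₃] : Fin 4 → K) lin₂ = 0 ∧
        g = lin₁ ^ 2 * lin₂)) →
      (C p₃ * X 0 - C p₂ * X 1 : MvPolynomial (Fin 2) K) ^ 5 ∣
        lineResultant K F alphaRed betaRed) := by
  have : Infinite K := IsAlgClosed.instInfinite
  obtain ⟨s, hs⟩ : ∃ s, cubicEval (planeCoeff F (1 : K) 0) 0 p₂ p₃ = s := ⟨_, rfl⟩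
  obtain ⟨t, ht⟩ : ∃ t, cubicEval (planeCoeff F (0 : K) 1) 0 p₂ p₃ = t := ⟨_, rfl⟩
  have hts : ¬(t = 0 ∧ s = 0) := by
    rintro ⟨rfl, rfl⟩
    obtain ⟨i, hi⟩ := hPsmooth
    exact hi (eval_pderiv_eq_zero hhom hline p₂ p₃ hs ht i)
  have hα : eval ![p₂, p₃] (alphaForm K F) = s := by
    rw [← hs, alphaForm_eq]
    simp [cubicEval, planeCoeff, algebraMap_eq]
  have hβ : eval ![p₂, p₃] (betaForm K F) = t := by
    rw [← ht, betaForm_eq]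
    simp [cubicEval, planeCoeff, algebraMap_eq]
  have hgam : eval ![p₂, p₃] gam ≠ 0 := by
    intro h
    refine hts ⟨?_, ?_⟩
    · rw [← hβ, hfacβ, map_mul, h, zero_mul]
    · rw [← hα, hfacα, map_mul, h, zero_mul]
  obtain ⟨q₂, q₃, hq⟩ : ∃ q₂ q₃ : K, q₂ * p₃ - q₃ * p₂ = 1 := by
    obtain ⟨u, v, huv⟩ := exists_mul_add_mul_eq_one hp
    exact ⟨v, -u, by linear_combination huv⟩
  have h₀ : cubicSubst (planeCoeff F t s) q₂ q₃ p₂ p₃ 0 0 3 = 0 := by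
    have h := cubicEval_planeCoeff_zero F t s p₂ p₃
    rw [hs, ht] at h
    have h2 : (2 : K) = 0 := CharTwo.two_eq_zero
    simp only [cubicEval] at h
    simp only [cubicSubst]
    linear_combination h + t * s * h2
  have hcontact : ∀ {W : Submodule K (Fin 4 → K)}, (∀ v ∈ W, eval v F = 0) →
      ![0, 0, p₂, p₃] ∈ W → ∀ {a : K}, ![t, s, a * q₂, a * q₃] ∈ W → ∀ n : ℕ,
      Polynomial.X ^ n ∣ aeval (pointLine ![0, 0, p₂, p₃] ![t, s, a * q₂, a * q₃]) F := by
    intro W hWF hP a ha n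
    rw [aeval_pointLine_eq_zero hWF hP ha]
    exact dvd_zero _
  have hdistinct : ∀ {W₁ W₂ : Submodule K (Fin 4 → K)}, W₁ ≠ W₂ → Module.finrank K W₁ = 2 →
      Module.finrank K W₂ = 2 → ![0, 0, p₂, p₃] ∈ W₁ → ![0, 0, p₂, p₃] ∈ W₂ → ∀ {a b : K},
      ![t, s, a * q₂, a * q₃] ∈ W₁ → ![t, s, b * q₂, b * q₃] ∈ W₂ → a ≠ b := by
    rintro W₁ W₂ hne hW₁ hW₂ hP₁ hP₂ a _ ha hb rfl
    exact hne ((eq_span_pair hp hts hW₁ hP₁ ha).symm.trans (eq_span_pair hp hts hW₂ hP₂ hb))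
  have hresidual : ∀ {u : K} {g : MvPolynomial (Fin 4) K},
      bind₁ (fun i : Fin 4 => if i = 0 then C u * X 1 else X i) F = X 1 * g →
      eval ![0, 0, p₂, p₃] g = 0 → ∀ {n : ℕ},
      (∀ Q, Polynomial.X ^ n ∣ aeval (pointLine ![0, 0, p₂, p₃] Q) g) → ∀ a : K,
      Polynomial.X ^ (n + 1) ∣
        aeval (pointLine ![0, 0, p₂, p₃] ![t, s, a * q₂, a * q₃]) F := by
    intro u g hg hP n h a
    have htan := tangent_of_residual hhom hline hg hP
    rw [hs, ht] at htan
    have hsu : t = s * u := by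
      rw [mul_comm]
      exact (CharTwo.add_eq_zero.mp htan).symm
    rw [hsu]
    exact X_mul_dvd_aeval_pointLine hg p₂ p₃ _ _ (h _)
  refine ⟨?_, ?_, ?_⟩
  · rintro ⟨W, hW, hWF, hne, hP⟩
    obtain ⟨a, ha⟩ := exists_mem_of_line hhom hline hq hts hs ht hW hWF hne hP
    exact dvd_lineResultant hfacα hfacβ hq hgam hts a h₀
      (of_X_pow_three_dvd hhom hline (hcontact hWF hP ha 3))
      (of_X_pow_four_dvd hhom hline (hcontact hWF hP ha 4))
  · rintro (⟨W₁, W₂, h₁₂, ⟨hW₁, hF₁, hne₁, hP₁⟩, ⟨hW₂, hF₂, hne₂, hP₂⟩⟩ |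
      ⟨u, g, lin, hg, -, -, hP, w, rfl⟩)
    · obtain ⟨a, ha⟩ := exists_mem_of_line hhom hline hq hts hs ht hW₁ hF₁ hne₁ hP₁
      obtain ⟨b, hb⟩ := exists_mem_of_line hhom hline hq hts hs ht hW₂ hF₂ hne₂ hP₂
      exact sq_dvd_lineResultant_of_two hhom hline hfacα hfacβ hq hgam hts h₀
        (hdistinct h₁₂ hW₁ hW₂ hP₁ hP₂ ha hb) (hcontact hF₁ hP₁ ha 3) (hcontact hF₂ hP₂ hb 3)
    · have h := hresidual hg (by simp [hP]) (n := 2) fun Q => by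
        rw [map_mul, map_pow]
        exact Dvd.dvd.mul_right (pow_dvd_pow_of_dvd (X_dvd_aeval_pointLine hP Q) 2) _
      exact sq_dvd_lineResultant_of_two hhom hline hfacα hfacβ hq hgam hts h₀ zero_ne_one
        (h 0) (h 1)
  · rintro (⟨W₁, W₂, W₃, h₁₂, h₁₃, h₂₃, ⟨hW₁, hF₁, hne₁, hP₁⟩, ⟨hW₂, hF₂, hne₂, hP₂⟩,
      ⟨hW₃, hF₃, hne₃, hP₃⟩⟩ | ⟨u, g, lin₁, lin₂, hg, -, -, -, -, hP₁, hP₂, rfl⟩)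
    · obtain ⟨a, ha⟩ := exists_mem_of_line hhom hline hq hts hs ht hW₁ hF₁ hne₁ hP₁
      obtain ⟨b, hb⟩ := exists_mem_of_line hhom hline hq hts hs ht hW₂ hF₂ hne₂ hP₂
      obtain ⟨c, hc⟩ := exists_mem_of_line hhom hline hq hts hs ht hW₃ hF₃ hne₃ hP₃
      exact pow_five_dvd_lineResultant_of_three hhom hline hfacα hfacβ hq hgam hts h₀
        (hdistinct h₁₂ hW₁ hW₂ hP₁ hP₂ ha hb) (hdistinct h₁₃ hW₁ hW₃ hP₁ hP₃ ha hc)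
        (hdistinct h₂₃ hW₂ hW₃ hP₂ hP₃ hb hc) (hcontact hF₁ hP₁ ha 4) (hcontact hF₂ hP₂ hb 4)
        (hcontact hF₃ hP₃ hc 4)
    · have h := hresidual hg (by simp [hP₁]) (n := 3) fun Q => by
        rw [map_mul, map_pow, pow_succ]
        exact mul_dvd_mul (pow_dvd_pow_of_dvd (X_dvd_aeval_pointLine hP₁ Q) 2)
          (X_dvd_aeval_pointLine hP₂ Q)
      classical
      obtain ⟨c, hc⟩ := Infinite.exists_notMem_finset ({0, 1} : Finset K)
      simp only [Finset.mem_insert, Finset.mem_singleton, not_or] at hc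
      exact pow_five_dvd_lineResultant_of_three hhom hline hfacα hfacβ hq hgam hts h₀ zero_ne_one
        (Ne.symm hc.1) (Ne.symm hc.2) (h 0) (h 1) (h c)
end
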